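/- arXiv:2511.14710 — 3 statements merged into one kernel-verified Lean document; each statement's English description precedes it below -/
import Mathlib

section
/- Assume (A1) and (A2), and let μ_z^* be a Stage-I selection. Then there exists μ_x^* ∈ P₂(ℝ^{d_x}) such that 𝓕₂(μ_x^*, μ_z^*(μ_x^*)) ≤ 𝓕₂(μ_x, μ_z^*(μ_x)) for all μ_x ∈ P₂(ℝ^{d_x}); moreover 𝓕₂(μ_x^*, μ_z^*(μ_x^*)) is finite, and every such minimizer μ_x^* is absolutely continuous with respect to Lebesgue measure on ℝ^{d_x}. -/
open MeasureTheory ProbabilityTheory Real Filter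
open scoped ENNReal Classical

noncomputable section

/-- `Euc d` is Euclidean space `ℝ^d`. -/
abbrev Euc (d : ℕ) : Type := EuclideanSpace ℝ (Fin d)

/-- `P₂(ℝ^d)`: Borel probability measures with finite second moment. -/
def IsP2 {d : ℕ} (μ : Measure (Euc d)) : Prop :=
  IsProbabilityMeasure μ ∧ Integrable (fun x => ‖x‖ ^ 2) μ

/-- Negative entropy of a probability measure, valued in `ℝ ∪ {+∞}` (as `EReal`):
the integral `∫ log(dμ/dLeb) dμ` if `μ` is absolutely continuous w.r.t. Lebesgue measure
and that integral exists in `ℝ`, and `+∞` otherwise. -/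
def Ent {d : ℕ} (μ : Measure (Euc d)) : EReal :=
  if μ ≪ (volume : Measure (Euc d)) ∧
      Integrable (fun x => Real.log (μ.rnDeriv volume x).toReal) μ then
    ((∫ x, Real.log (μ.rnDeriv volume x).toReal ∂μ : ℝ) : EReal)
  else ⊤

/-- Kullback–Leibler divergence `KL(ν, μ)`, valued in `ℝ ∪ {+∞}` (as `EReal`). -/
def KL {α : Type*} [MeasurableSpace α] (ν μ : Measure α) : EReal :=
  if ν ≪ μ ∧ Integrable (fun x => Real.log (ν.rnDeriv μ x).toReal) ν then
    ((∫ x, Real.log (ν.rnDeriv μ x).toReal ∂ν : ℝ) : EReal)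
  else ⊤

section Setting

variable {da dw dx dz : ℕ}

/-- Stage-I unregularized objective `U₁`. -/
def U1 (ρ : Measure (Euc da × Euc dw × ℝ)) (ΨA : Euc da → Euc dx → ℝ)
    (ΨW : Euc dw → Euc dz → ℝ) (μx : Measure (Euc dx)) (μz : Measure (Euc dz)) : ℝ :=
  (1 / 2) * ∫ p, ((∫ z, ΨW p.2.1 z ∂μz) - (∫ x, ΨA p.1 x ∂μx)) ^ 2 ∂ρ

/-- Stage-II unregularized objective `U₂`. -/
def U2 (ρ : Measure (Euc da × Euc dw × ℝ)) (ΨW : Euc dw → Euc dz → ℝ)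
    (μz : Measure (Euc dz)) : ℝ :=
  (1 / 2) * ∫ p, ((∫ z, ΨW p.2.1 z ∂μz) - p.2.2) ^ 2 ∂ρ

/-- `F₁ = U₁ + (ζ₁/2)·second moment of μ_z`. -/
def F1 (ρ : Measure (Euc da × Euc dw × ℝ)) (ΨA : Euc da → Euc dx → ℝ)
    (ΨW : Euc dw → Euc dz → ℝ) (ζ1 : ℝ) (μx : Measure (Euc dx)) (μz : Measure (Euc dz)) : ℝ :=
  U1 ρ ΨA ΨW μx μz + (ζ1 / 2) * ∫ z, ‖z‖ ^ 2 ∂μz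

/-- `F₂ = U₂ + (ζ₂/2)·second moment of μ_x`. -/
def F2 (ρ : Measure (Euc da × Euc dw × ℝ)) (ΨW : Euc dw → Euc dz → ℝ) (ζ2 : ℝ)
    (μx : Measure (Euc dx)) (μz : Measure (Euc dz)) : ℝ :=
  U2 ρ ΨW μz + (ζ2 / 2) * ∫ x, ‖x‖ ^ 2 ∂μx

/-- `𝓕₁ = F₁ + σ₁·Ent(μ_z)`, valued in `ℝ ∪ {+∞}`. -/
def calF1 (ρ : Measure (Euc da × Euc dw × ℝ)) (ΨA : Euc da → Euc dx → ℝ)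
    (ΨW : Euc dw → Euc dz → ℝ) (ζ1 σ1 : ℝ) (μx : Measure (Euc dx))
    (μz : Measure (Euc dz)) : EReal :=
  ((F1 ρ ΨA ΨW ζ1 μx μz : ℝ) : EReal) + (σ1 : EReal) * Ent μz

/-- `𝓕₂ = F₂ + σ₂·Ent(μ_x)`, valued in `ℝ ∪ {+∞}`. -/
def calF2 (ρ : Measure (Euc da × Euc dw × ℝ)) (ΨW : Euc dw → Euc dz → ℝ) (ζ2 σ2 : ℝ)
    (μx : Measure (Euc dx)) (μz : Measure (Euc dz)) : EReal :=
  ((F2 ρ ΨW ζ2 μx μz : ℝ) : EReal) + (σ2 : EReal) * Ent μx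

/-- Assumption (A1): bounded target, `|y| ≤ M` for `ρ`-a.e. `(𝐚, 𝐰, y)`. -/
def A1 (ρ : Measure (Euc da × Euc dw × ℝ)) (M : ℝ) : Prop :=
  ∀ᵐ p ∂ρ, |p.2.2| ≤ M

/-- Assumption (A2): jointly measurable, bounded and smooth networks with bounded gradients. -/
def A2 (ΨA : Euc da → Euc dx → ℝ) (ΨW : Euc dw → Euc dz → ℝ) (R : ℝ) : Prop :=
  Measurable (Function.uncurry ΨA) ∧ Measurable (Function.uncurry ΨW) ∧
    (∀ a x, |ΨA a x| ≤ R) ∧ (∀ w z, |ΨW w z| ≤ R) ∧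
    (∀ a, Differentiable ℝ (ΨA a)) ∧ (∀ a x, ‖fderiv ℝ (ΨA a) x‖ ≤ R) ∧
    (∀ w, Differentiable ℝ (ΨW w)) ∧ (∀ w z, ‖fderiv ℝ (ΨW w) z‖ ≤ R)

/-- A Stage-I selection: to each `μ_x ∈ P₂` it assigns a global minimizer of `𝓕₁(μ_x, ·)`
over `P₂(ℝ^{d_z})`, with finite value. -/
def IsStageOneSel (ρ : Measure (Euc da × Euc dw × ℝ)) (ΨA : Euc da → Euc dx → ℝ)
    (ΨW : Euc dw → Euc dz → ℝ) (ζ1 σ1 : ℝ)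
    (sel : Measure (Euc dx) → Measure (Euc dz)) : Prop :=
  ∀ μx, IsP2 μx →
    IsP2 (sel μx) ∧ calF1 ρ ΨA ΨW ζ1 σ1 μx (sel μx) ≠ ⊤ ∧
      calF1 ρ ΨA ΨW ζ1 σ1 μx (sel μx) ≠ ⊥ ∧
      ∀ ν, IsP2 ν → calF1 ρ ΨA ΨW ζ1 σ1 μx (sel μx) ≤ calF1 ρ ΨA ΨW ζ1 σ1 μx ν

/-- The Lagrangian `𝓛_λ(μ_x, μ_z) = 𝓕₂(μ_x, μ_z) + λ(𝓕₁(μ_x, μ_z) − 𝓕₁(μ_x, μ_z^*(μ_x)))`. -/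
def Lag (ρ : Measure (Euc da × Euc dw × ℝ)) (ΨA : Euc da → Euc dx → ℝ)
    (ΨW : Euc dw → Euc dz → ℝ) (ζ1 ζ2 σ1 σ2 : ℝ)
    (sel : Measure (Euc dx) → Measure (Euc dz)) (lam : ℝ)
    (μx : Measure (Euc dx)) (μz : Measure (Euc dz)) : EReal :=
  calF2 ρ ΨW ζ2 σ2 μx μz +
    (lam : EReal) * (calF1 ρ ΨA ΨW ζ1 σ1 μx μz - calF1 ρ ΨA ΨW ζ1 σ1 μx (sel μx))

end Setting

section Preliminaries

open InformationTheory Topology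

lemma mul_log_sub_ge {a b : ℝ} (ha : 0 ≤ a) (hb : 0 ≤ b) (hab : b = 0 → a = 0) :
    2 * (a - √a * √b) ≤ a * log a - a * log b := by
  rcases ha.eq_or_lt with rfl | ha
  · simp
  have hb : 0 < b := lt_of_le_of_ne hb fun h => ha.ne' (hab h.symm)
  have h := Real.log_le_sub_one_of_pos (div_pos (sqrt_pos.2 hb) (sqrt_pos.2 ha))
  rw [log_div (sqrt_pos.2 hb).ne' (sqrt_pos.2 ha).ne', log_sqrt hb.le, log_sqrt ha.le] at h
  have h2 := mul_le_mul_of_nonneg_left h ha.le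
  have h3 : a * (√b / √a - 1) = √a * √b - a := by
    have : √a ≠ 0 := (sqrt_pos.2 ha).ne'
    field_simp
    linear_combination (-√b) * sq_sqrt ha.le
  linarith

/-- Midpoint strong convexity of `klFun` with a Hellinger-type modulus. -/
lemma klFun_midpoint_le {x y : ℝ} (hx : 0 ≤ x) (hy : 0 ≤ y) :
    klFun ((x + y) / 2) + 1 / 4 * (√x - √y) ^ 2 ≤ (klFun x + klFun y) / 2 := by
  have hm : 0 ≤ (x + y) / 2 := by positivity
  have h1 := mul_log_sub_ge hx hm fun h => by linarith
  have h2 := mul_log_sub_ge hy hm fun h => by linarith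
  simp only [klFun]
  nlinarith [sq_sqrt hx, sq_sqrt hy, sq_sqrt hm, sq_nonneg (√x + √y - 2 * √((x + y) / 2))]

lemma abs_sub_le_sqrt_sub_sq {x y η : ℝ} (hx : 0 ≤ x) (hy : 0 ≤ y) (hη : 0 < η) :
    |x - y| ≤ 1 / (2 * η) * (√x - √y) ^ 2 + η * (x + y) := by
  have key : ∀ a b : ℝ, a ^ 2 - b ^ 2 ≤ 1 / (2 * η) * (a - b) ^ 2 + η * (a ^ 2 + b ^ 2) := by
    intro a b
    have h : 0 ≤ 1 / (2 * η) * ((a - b) - η * (a + b)) ^ 2 := by positivity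
    have h2 : 1 / (2 * η) * ((a - b) - η * (a + b)) ^ 2
        = 1 / (2 * η) * (a - b) ^ 2 - (a - b) * (a + b) + η / 2 * (a + b) ^ 2 := by
      field_simp; ring
    nlinarith [mul_nonneg hη.le (sq_nonneg (a - b))]
  have h1 := key √x √y
  have h2 := key √y √x
  rw [sq_sqrt hx, sq_sqrt hy] at h1 h2
  rw [abs_le]
  constructor <;> nlinarith

lemma mul_le_klFun_add_exp {t : ℝ} (ht : 0 ≤ t) (s : ℝ) : t * s ≤ klFun t + (exp s - 1) := by
  rcases ht.eq_or_lt with rfl | ht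
  · simp [klFun, (exp_pos s).le]
  have h := add_one_le_exp (s - log t)
  rw [exp_sub, exp_log ht, le_div_iff₀ ht] at h
  simp only [klFun]
  nlinarith

/-- The equal-weight mixture of two measures. -/
def midMeasure {α : Type*} [MeasurableSpace α] (μ ν : Measure α) : Measure α :=
  (2⁻¹ : ℝ≥0∞) • μ + (2⁻¹ : ℝ≥0∞) • ν

section Mid

variable {α : Type*} [MeasurableSpace α] {μ ν γ : Measure α}

instance [IsProbabilityMeasure μ] [IsProbabilityMeasure ν] :
    IsProbabilityMeasure (midMeasure μ ν) :=
  ⟨by simp [midMeasure, ENNReal.inv_two_add_inv_two]⟩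

lemma integrable_midMeasure {f : α → ℝ} (hμ : Integrable f μ) (hν : Integrable f ν) :
    Integrable f (midMeasure μ ν) :=
  (hμ.smul_measure (by simp)).add_measure (hν.smul_measure (by simp))

lemma integral_midMeasure {f : α → ℝ} (hμ : Integrable f μ) (hν : Integrable f ν) :
    ∫ x, f x ∂midMeasure μ ν = (∫ x, f x ∂μ + ∫ x, f x ∂ν) / 2 := by
  rw [midMeasure, integral_add_measure (hμ.smul_measure (by simp)) (hν.smul_measure (by simp)),
    integral_smul_measure, integral_smul_measure]
  simp
  ring

lemma toReal_rnDeriv_midMeasure [IsFiniteMeasure μ] [IsFiniteMeasure ν] [SigmaFinite γ] :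
    (fun x => ((midMeasure μ ν).rnDeriv γ x).toReal) =ᵐ[γ]
      fun x => ((μ.rnDeriv γ x).toReal + (ν.rnDeriv γ x).toReal) / 2 := by
  have : IsFiniteMeasure ((2⁻¹ : ℝ≥0∞) • μ) := μ.smul_finite (by simp)
  have : IsFiniteMeasure ((2⁻¹ : ℝ≥0∞) • ν) := ν.smul_finite (by simp)
  filter_upwards [Measure.rnDeriv_add ((2⁻¹ : ℝ≥0∞) • μ) ((2⁻¹ : ℝ≥0∞) • ν) γ,
    Measure.rnDeriv_smul_left_of_ne_top μ γ (r := 2⁻¹) (by simp),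
    Measure.rnDeriv_smul_left_of_ne_top ν γ (r := 2⁻¹) (by simp),
    Measure.rnDeriv_lt_top μ γ, Measure.rnDeriv_lt_top ν γ] with x h1 h2 h3 h4 h5
  rw [midMeasure, h1, Pi.add_apply, h2, h3]
  simp only [Pi.smul_apply, smul_eq_mul]
  rw [ENNReal.toReal_add (ENNReal.mul_ne_top (by simp) h4.ne)
    (ENNReal.mul_ne_top (by simp) h5.ne)]
  simp
  ring

lemma integrable_klFun_rnDeriv_of_klDiv_ne_top [IsFiniteMeasure μ] [IsFiniteMeasure γ]
    (hμ : klDiv μ γ ≠ ∞) : Integrable (fun x => klFun (μ.rnDeriv γ x).toReal) γ := by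
  obtain ⟨h1, h2⟩ := klDiv_ne_top_iff.1 hμ
  exact (integrable_klFun_rnDeriv_iff h1).2 h2

lemma toReal_klDiv_eq_integral_of_ne_top [IsFiniteMeasure μ] [IsFiniteMeasure γ]
    (hμ : klDiv μ γ ≠ ∞) : (klDiv μ γ).toReal = ∫ x, klFun (μ.rnDeriv γ x).toReal ∂γ :=
  toReal_klDiv_eq_integral_klFun (klDiv_ne_top_iff.1 hμ).1

/-- Midpoint strong convexity of the Kullback–Leibler divergence. -/
lemma klDiv_midMeasure [IsProbabilityMeasure μ] [IsProbabilityMeasure ν] [IsProbabilityMeasure γ]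
    (hμ : klDiv μ γ ≠ ∞) (hν : klDiv ν γ ≠ ∞) :
    klDiv (midMeasure μ ν) γ ≠ ∞ ∧
    Integrable (fun x => (√(μ.rnDeriv γ x).toReal - √(ν.rnDeriv γ x).toReal) ^ 2) γ ∧
    (klDiv (midMeasure μ ν) γ).toReal +
      1 / 4 * ∫ x, (√(μ.rnDeriv γ x).toReal - √(ν.rnDeriv γ x).toReal) ^ 2 ∂γ ≤
      ((klDiv μ γ).toReal + (klDiv ν γ).toReal) / 2 := by
  have iμ := integrable_klFun_rnDeriv_of_klDiv_ne_top hμ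
  have iν := integrable_klFun_rnDeriv_of_klDiv_ne_top hν
  have hac : midMeasure μ ν ≪ γ :=
    ((klDiv_ne_top_iff.1 hμ).1.smul_left _).add_left ((klDiv_ne_top_iff.1 hν).1.smul_left _)
  have iavg := (iμ.add iν).div_const 2
  have hpt : ∀ᵐ x ∂γ, klFun ((midMeasure μ ν).rnDeriv γ x).toReal +
      1 / 4 * (√(μ.rnDeriv γ x).toReal - √(ν.rnDeriv γ x).toReal) ^ 2 ≤
      (klFun (μ.rnDeriv γ x).toReal + klFun (ν.rnDeriv γ x).toReal) / 2 := by
    filter_upwards [toReal_rnDeriv_midMeasure (μ := μ) (ν := ν) (γ := γ)] with x hx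
    rw [hx]
    exact klFun_midpoint_le ENNReal.toReal_nonneg ENNReal.toReal_nonneg
  have imid : Integrable (fun x => klFun ((midMeasure μ ν).rnDeriv γ x).toReal) γ := by
    refine iavg.mono' (measurable_klFun.comp
      (Measure.measurable_rnDeriv _ _).ennreal_toReal).aestronglyMeasurable ?_
    filter_upwards [hpt] with x hx
    rw [norm_of_nonneg (klFun_nonneg ENNReal.toReal_nonneg)]
    simp only [Pi.add_apply]
    nlinarith [sq_nonneg (√(μ.rnDeriv γ x).toReal - √(ν.rnDeriv γ x).toReal)]
  have isq : Integrable
      (fun x => (√(μ.rnDeriv γ x).toReal - √(ν.rnDeriv γ x).toReal) ^ 2) γ := by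
    refine (iavg.const_mul 4).mono' (by fun_prop) ?_
    filter_upwards [hpt] with x hx
    rw [norm_of_nonneg (sq_nonneg _)]
    simp only [Pi.add_apply]
    nlinarith [klFun_nonneg (x := ((midMeasure μ ν).rnDeriv γ x).toReal) ENNReal.toReal_nonneg]
  have hmid : klDiv (midMeasure μ ν) γ ≠ ∞ :=
    klDiv_ne_top hac ((integrable_klFun_rnDeriv_iff hac).1 imid)
  refine ⟨hmid, isq, ?_⟩
  rw [toReal_klDiv_eq_integral_of_ne_top hμ, toReal_klDiv_eq_integral_of_ne_top hν,
    toReal_klDiv_eq_integral_of_ne_top hmid, ← integral_const_mul,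
    ← integral_add imid (isq.const_mul _), ← integral_add iμ iν, ← integral_div]
  exact integral_mono_ae (imid.add (isq.const_mul _)) iavg hpt

end Mid

section Limit

variable {α : Type*} [MeasurableSpace α] {γ : Measure α} [IsProbabilityMeasure γ]

lemma integral_abs_rnDeriv_sub_le {μ ν : Measure α} [IsProbabilityMeasure μ]
    [IsProbabilityMeasure ν] (hμ : klDiv μ γ ≠ ∞) (hν : klDiv ν γ ≠ ∞) {η : ℝ} (hη : 0 < η) :
    ∫ x, |(μ.rnDeriv γ x).toReal - (ν.rnDeriv γ x).toReal| ∂γ ≤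
      2 / η * (((klDiv μ γ).toReal + (klDiv ν γ).toReal) / 2 -
        (klDiv (midMeasure μ ν) γ).toReal) + 2 * η := by
  obtain ⟨-, isq, h⟩ := klDiv_midMeasure hμ hν
  have i1 : Integrable (fun x => (μ.rnDeriv γ x).toReal) γ := Measure.integrable_toReal_rnDeriv
  have i2 : Integrable (fun x => (ν.rnDeriv γ x).toReal) γ := Measure.integrable_toReal_rnDeriv
  have i3 : Integrable (fun x => (μ.rnDeriv γ x).toReal + (ν.rnDeriv γ x).toReal) γ := i1.add i2
  have h1 : ∫ x, (μ.rnDeriv γ x).toReal ∂γ = 1 := by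
    simp [Measure.integral_toReal_rnDeriv (klDiv_ne_top_iff.1 hμ).1]
  have h2 : ∫ x, (ν.rnDeriv γ x).toReal ∂γ = 1 := by
    simp [Measure.integral_toReal_rnDeriv (klDiv_ne_top_iff.1 hν).1]
  have hle : ∫ x, |(μ.rnDeriv γ x).toReal - (ν.rnDeriv γ x).toReal| ∂γ ≤
      ∫ x, (1 / (2 * η) * (√(μ.rnDeriv γ x).toReal - √(ν.rnDeriv γ x).toReal) ^ 2 +
        η * ((μ.rnDeriv γ x).toReal + (ν.rnDeriv γ x).toReal)) ∂γ :=
    integral_mono (i1.sub i2).abs ((isq.const_mul _).add (i3.const_mul _)) fun x =>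
      abs_sub_le_sqrt_sub_sq ENNReal.toReal_nonneg ENNReal.toReal_nonneg hη
  rw [integral_add (isq.const_mul _) (i3.const_mul _), integral_const_mul,
    integral_const_mul, integral_add i1 i2, h1, h2] at hle
  have h3 : 1 / (2 * η) * ∫ x, (√(μ.rnDeriv γ x).toReal - √(ν.rnDeriv γ x).toReal) ^ 2 ∂γ ≤
      1 / (2 * η) * (4 * (((klDiv μ γ).toReal + (klDiv ν γ).toReal) / 2 -
        (klDiv (midMeasure μ ν) γ).toReal)) :=
    mul_le_mul_of_nonneg_left (by linarith) (by positivity)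
  have h4 : ∀ t : ℝ, 1 / (2 * η) * (4 * t) = 2 / η * t := fun t => by field_simp; ring
  rw [h4] at h3
  linarith

/-- Probability measures with bounded divergence whose densities are Cauchy in `L¹` converge,
and the divergence is lower semicontinuous along the sequence. -/
lemma exists_limit_of_cauchy_rnDeriv {μs : ℕ → Measure α} [∀ n, IsProbabilityMeasure (μs n)]
    (hkl : ∀ n, klDiv (μs n) γ ≠ ∞) {L : ℝ} {e : ℕ → ℝ} (he : Tendsto e atTop (𝓝 0))
    (hL : ∀ n, (klDiv (μs n) γ).toReal ≤ L + e n)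
    (hc : ∀ ε > 0, ∃ N, ∀ n ≥ N, ∀ m ≥ N,
      ∫ x, |((μs n).rnDeriv γ x).toReal - ((μs m).rnDeriv γ x).toReal| ∂γ < ε) :
    ∃ μ : Measure α, IsProbabilityMeasure μ ∧ klDiv μ γ ≠ ∞ ∧ (klDiv μ γ).toReal ≤ L ∧
      ∀ (φ : α → ℝ) (B : ℝ), Measurable φ → (∀ x, |φ x| ≤ B) →
        Tendsto (fun n => ∫ x, φ x ∂μs n) atTop (𝓝 (∫ x, φ x ∂μ)) := by
  have hac : ∀ n, μs n ≪ γ := fun n => (klDiv_ne_top_iff.1 (hkl n)).1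
  have hi : ∀ n, Integrable (fun x => ((μs n).rnDeriv γ x).toReal) γ :=
    fun n => Measure.integrable_toReal_rnDeriv
  have hone : ∀ n, ∫ x, ((μs n).rnDeriv γ x).toReal ∂γ = 1 := fun n => by
    simp [Measure.integral_toReal_rnDeriv (hac n)]
  have hdist : ∀ {f g : α → ℝ} (hf : Integrable f γ) (hg : Integrable g γ),
      dist (hf.toL1 f) (hg.toL1 g) = ∫ x, |f x - g x| ∂γ := by
    intro f g hf hg
    rw [dist_eq_norm, ← Integrable.toL1_sub, L1.norm_eq_integral_norm]
    exact integral_congr_ae (by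
      filter_upwards [(hf.sub hg).coeFn_toL1] with x hx
      rw [hx, Pi.sub_apply, norm_eq_abs])
  have hcau : CauchySeq fun n => (hi n).toL1 _ := by
    rw [Metric.cauchySeq_iff]
    intro ε hε
    obtain ⟨N, hN⟩ := hc ε hε
    exact ⟨N, fun n hn m hm => by rw [hdist]; exact hN n hn m hm⟩
  obtain ⟨G, hG⟩ := cauchySeq_tendsto_of_complete hcau
  set g : α → ℝ := fun x => G x with hg
  have ig : Integrable g γ := L1.integrable_coeFn G
  have hGt : ig.toL1 g = G := Integrable.toL1_coeFn G ig
  have hlim : Tendsto (fun n => ∫ x, |((μs n).rnDeriv γ x).toReal - g x| ∂γ) atTop (𝓝 0) := by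
    have := tendsto_iff_dist_tendsto_zero.1 hG
    simp only [← hGt] at this
    simpa only [hdist] using this
  have hmeas : TendstoInMeasure γ (fun n x => ((μs n).rnDeriv γ x).toReal) atTop g := by
    refine tendstoInMeasure_of_tendsto_eLpNorm one_ne_zero
      (fun n => (hi n).aestronglyMeasurable) ig.aestronglyMeasurable ?_
    have : ∀ n, eLpNorm ((fun x => ((μs n).rnDeriv γ x).toReal) - g) 1 γ =
        ENNReal.ofReal (∫ x, |((μs n).rnDeriv γ x).toReal - g x| ∂γ) := fun n => by
      rw [eLpNorm_one_eq_lintegral_enorm, ← ofReal_integral_norm_eq_lintegral_enorm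
        ((hi n).sub ig)]
      rfl
    simp only [this]
    simpa using ENNReal.tendsto_ofReal hlim
  obtain ⟨ns, hns, hae⟩ := hmeas.exists_seq_tendsto_ae
  have g0 : 0 ≤ᵐ[γ] g := by
    filter_upwards [hae] with x hx
    exact ge_of_tendsto' hx fun n => ENNReal.toReal_nonneg
  have hφ : ∀ (φ : α → ℝ) (B : ℝ), Measurable φ → (∀ x, |φ x| ≤ B) →
      Tendsto (fun n => ∫ x, φ x ∂μs n) atTop (𝓝 (∫ x, g x * φ x ∂γ)) := by
    intro φ B hφ hB
    have hib : ∀ {f : α → ℝ}, Integrable f γ → Integrable (fun x => f x * φ x) γ := fun hf =>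
      hf.mul_bdd (c := B) hφ.aestronglyMeasurable (Eventually.of_forall hB)
    rw [tendsto_iff_dist_tendsto_zero]
    refine squeeze_zero (fun n => dist_nonneg) (fun n => ?_)
      (by simpa using hlim.const_mul B)
    rw [← integral_rnDeriv_smul (hac n)]
    simp only [smul_eq_mul]
    rw [dist_eq_norm, ← integral_sub (hib (hi n)) (hib ig), ← integral_const_mul]
    refine norm_integral_le_of_norm_le (((hi n).sub ig).abs.const_mul B)
      (Eventually.of_forall fun x => ?_)
    rw [← sub_mul, norm_mul, mul_comm]
    exact mul_le_mul_of_nonneg_right (hB x) (abs_nonneg _)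
  have hg1 : ∫ x, g x ∂γ = 1 := by
    have h := hφ (fun _ => 1) 1 measurable_const (by simp)
    simp only [mul_one, integral_const, probReal_univ, smul_eq_mul] at h
    exact (tendsto_nhds_unique h tendsto_const_nhds)
  set μ : Measure α := γ.withDensity fun x => ENNReal.ofReal (g x) with hμ
  have hgm : AEMeasurable (fun x => ENNReal.ofReal (g x)) γ :=
    ig.aestronglyMeasurable.aemeasurable.ennreal_ofReal
  have hμp : IsProbabilityMeasure μ := ⟨by
    rw [hμ, withDensity_apply _ MeasurableSet.univ, Measure.restrict_univ,
      ← ofReal_integral_eq_lintegral_ofReal ig g0, hg1, ENNReal.ofReal_one]⟩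
  have hμac : μ ≪ γ := withDensity_absolutelyContinuous _ _
  have hrn : (fun x => (μ.rnDeriv γ x).toReal) =ᵐ[γ] g := by
    filter_upwards [Measure.rnDeriv_withDensity₀ γ hgm, g0] with x hx h0
    rw [hμ, hx, ENNReal.toReal_ofReal h0]
  have hle : klDiv μ γ ≤ ENNReal.ofReal L := by
    rw [klDiv_eq_lintegral_klFun_of_ac hμac]
    have h1 : ∫⁻ x, ENNReal.ofReal (klFun (μ.rnDeriv γ x).toReal) ∂γ ≤
        ∫⁻ x, liminf (fun k =>
          ENNReal.ofReal (klFun ((μs (ns k)).rnDeriv γ x).toReal)) atTop ∂γ := by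
      refine lintegral_mono_ae ?_
      filter_upwards [hae, hrn] with x hx hx2
      have : Tendsto (fun k => ENNReal.ofReal (klFun ((μs (ns k)).rnDeriv γ x).toReal)) atTop
          (𝓝 (ENNReal.ofReal (klFun (g x)))) :=
        ENNReal.tendsto_ofReal ((continuous_klFun.tendsto _).comp hx)
      rw [this.liminf_eq, hx2]
    refine h1.trans ((lintegral_liminf_le fun k => (measurable_klFun.comp
      (Measure.measurable_rnDeriv _ _).ennreal_toReal).ennreal_ofReal).trans ?_)
    have h2 : Tendsto (fun k => ENNReal.ofReal (L + e (ns k))) atTop (𝓝 (ENNReal.ofReal L)) := by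
      refine ENNReal.tendsto_ofReal ?_
      simpa using (he.comp hns.tendsto_atTop).const_add L
    rw [← h2.liminf_eq]
    refine liminf_le_liminf (Eventually.of_forall fun k => ?_)
    change ∫⁻ x, ENNReal.ofReal (klFun ((μs (ns k)).rnDeriv γ x).toReal) ∂γ ≤
      ENNReal.ofReal (L + e (ns k))
    rw [← klDiv_eq_lintegral_klFun_of_ac (hac _)]
    exact (ENNReal.le_ofReal_iff_toReal_le (hkl _)
      (ENNReal.toReal_nonneg.trans (hL _))).2 (hL _)
  have hL0 : 0 ≤ L := by
    have : Tendsto (fun n => L + e n) atTop (𝓝 L) := by simpa using he.const_add L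
    exact ge_of_tendsto' this fun n => ENNReal.toReal_nonneg.trans (hL n)
  refine ⟨μ, hμp, ne_top_of_le_ne_top ENNReal.ofReal_ne_top hle,
    ENNReal.toReal_le_of_le_ofReal hL0 hle, fun φ B hm hB => ?_⟩
  have : ∫ x, φ x ∂μ = ∫ x, g x * φ x ∂γ := by
    rw [← integral_rnDeriv_smul hμac]
    refine integral_congr_ae ?_
    filter_upwards [hrn] with x hx
    rw [hx, smul_eq_mul]
  rw [this]
  exact hφ φ B hm hB

/-- A decreasing family of midpoint-convex sets of probability measures, each containing measures
of divergence at most about `L`, has members converging to a measure of divergence at most `L`. -/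
lemma exists_limit_of_antitone_midConvex {K : ℕ → Set (Measure α)} (hK : Antitone K)
    (hp : ∀ n, ∀ μ ∈ K n, IsProbabilityMeasure μ)
    (hmid : ∀ n, ∀ μ ∈ K n, ∀ ν ∈ K n, midMeasure μ ν ∈ K n) {L : ℝ}
    (hL : ∀ n, ∀ ε > 0, ∃ μ ∈ K n, klDiv μ γ ≠ ∞ ∧ (klDiv μ γ).toReal ≤ L + ε) :
    ∃ (μ : Measure α) (μs : ℕ → Measure α), (∀ n, μs n ∈ K n) ∧ IsProbabilityMeasure μ ∧
      klDiv μ γ ≠ ∞ ∧ (klDiv μ γ).toReal ≤ L ∧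
      ∀ (φ : α → ℝ) (B : ℝ), Measurable φ → (∀ x, |φ x| ≤ B) →
        Tendsto (fun n => ∫ x, φ x ∂μs n) atTop (𝓝 (∫ x, φ x ∂μ)) := by
  set V : ℕ → Set ℝ := fun n =>
    (fun μ : Measure α => (klDiv μ γ).toReal) '' {μ | μ ∈ K n ∧ klDiv μ γ ≠ ∞} with hV
  have hbdd : ∀ n, BddBelow (V n) := fun n => ⟨0, by
    rintro _ ⟨μ, -, rfl⟩
    exact ENNReal.toReal_nonneg⟩
  have hne : ∀ n, (V n).Nonempty := fun n => by
    obtain ⟨μ, h1, h2, -⟩ := hL n 1 one_pos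
    exact ⟨_, μ, ⟨h1, h2⟩, rfl⟩
  have hmono : Monotone fun n => sInf (V n) := fun n m hnm =>
    csInf_le_csInf (hbdd n) (hne m) (Set.image_mono fun μ hμ => ⟨hK hnm hμ.1, hμ.2⟩)
  have hle : ∀ n, sInf (V n) ≤ L := fun n => le_of_forall_pos_le_add fun ε hε => by
    obtain ⟨μ, h1, h2, h3⟩ := hL n ε hε
    exact (csInf_le (hbdd n) ⟨μ, ⟨h1, h2⟩, rfl⟩).trans h3
  have hpos : ∀ n : ℕ, (0 : ℝ) < 1 / ((n : ℝ) + 1) := fun n => Nat.one_div_pos_of_nat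
  have hex : ∀ n : ℕ, ∃ μ ∈ K n, klDiv μ γ ≠ ∞ ∧
      (klDiv μ γ).toReal ≤ sInf (V n) + 1 / ((n : ℝ) + 1) := fun n => by
    obtain ⟨_, ⟨μ, hμ, rfl⟩, h⟩ := Real.lt_sInf_add_pos (hne n) (hpos n)
    exact ⟨μ, hμ.1, hμ.2, h.le⟩
  choose μs hμK hμkl hμle using hex
  have : ∀ n, IsProbabilityMeasure (μs n) := fun n => hp n _ (hμK n)
  obtain ⟨I, hI⟩ : ∃ I, Tendsto (fun n => sInf (V n)) atTop (𝓝 I) :=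
    ⟨_, tendsto_atTop_ciSup hmono ⟨L, by rintro _ ⟨n, rfl⟩; exact hle n⟩⟩
  have hone : Tendsto (fun n : ℕ => 1 / ((n : ℝ) + 1)) atTop (𝓝 0) :=
    tendsto_one_div_add_atTop_nhds_zero_nat
  obtain ⟨μ, h1, h2, h3, h4⟩ := exists_limit_of_cauchy_rnDeriv (γ := γ) (μs := μs) hμkl hone
    (fun n => (hμle n).trans (by linarith [hle n])) (fun ε hε => by
      have hη : 0 < ε / 4 := by positivity
      have hδ : 0 < ε ^ 2 / 64 := by positivity
      obtain ⟨N1, hN1⟩ := Metric.tendsto_atTop.1 hI _ hδ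
      obtain ⟨N2, hN2⟩ := Metric.tendsto_atTop.1 hone _ hδ
      have main : ∀ n ≥ max N1 N2, ∀ m ≥ n,
          ∫ x, |((μs n).rnDeriv γ x).toReal - ((μs m).rnDeriv γ x).toReal| ∂γ < ε := by
        intro n hn m hm
        have hmidK : midMeasure (μs n) (μs m) ∈ K n :=
          hmid n _ (hμK n) _ (hK hm (hμK m))
        have hmidle : sInf (V n) ≤ (klDiv (midMeasure (μs n) (μs m)) γ).toReal :=
          csInf_le (hbdd n) ⟨_, ⟨hmidK, (klDiv_midMeasure (hμkl n) (hμkl m)).1⟩, rfl⟩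
        have hnm := integral_abs_rnDeriv_sub_le (hμkl n) (hμkl m) hη
        have a1 := hN1 n (le_trans (le_max_left _ _) hn)
        have a2 := hN1 m (le_trans (le_max_left _ _) (hn.trans hm))
        have b1 := hN2 n (le_trans (le_max_right _ _) hn)
        have b2 := hN2 m (le_trans (le_max_right _ _) (hn.trans hm))
        rw [Real.dist_eq, abs_lt] at a1 a2 b1 b2
        have hlt : ((klDiv (μs n) γ).toReal + (klDiv (μs m) γ).toReal) / 2 -
            (klDiv (midMeasure (μs n) (μs m)) γ).toReal < 2 * (ε ^ 2 / 64) := by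
          linarith [hμle n, hμle m]
        have := mul_lt_mul_of_pos_left hlt (show 0 < 2 / (ε / 4) by positivity)
        have e1 : 2 / (ε / 4) * (2 * (ε ^ 2 / 64)) = ε / 4 := by field_simp; ring
        generalize 2 / (ε / 4) = t at *
        linarith
      refine ⟨max N1 N2, fun n hn m hm => ?_⟩
      rcases le_total n m with h | h
      · exact main n hn m h
      · simp_rw [abs_sub_comm (((μs n).rnDeriv γ _).toReal)]
        exact main m hm n h)
  exact ⟨μ, μs, hμK, h1, h2, h3, h4⟩

end Limit

section Gibbs

/-- The centred Gaussian measure with density proportional to `exp (-c ‖x‖ ^ 2)`. -/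
def gibbs (d : ℕ) (c : ℝ) : Measure (Euc d) :=
  (volume : Measure (Euc d)).tilted fun x => -(c * ‖x‖ ^ 2)

/-- The logarithm of the normalizing constant of `gibbs d c`. -/
def gibbsLog (d : ℕ) (c : ℝ) : ℝ := log (∫ x : Euc d, exp (-(c * ‖x‖ ^ 2)))

variable {d : ℕ} {c : ℝ}

lemma integrable_exp_neg_mul_norm_sq (hc : 0 < c) :
    Integrable fun x : Euc d => exp (-(c * ‖x‖ ^ 2)) := by
  have h := (GaussianFourier.integrable_cexp_neg_mul_sq_norm_add (V := Euc d) (b := (c : ℂ))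
    (by simpa using hc) 0 0).norm
  refine h.congr (Eventually.of_forall fun x => ?_)
  simp only [Complex.norm_exp]
  congr 1
  simp [← Complex.ofReal_pow]

lemma isProbabilityMeasure_gibbs (hc : 0 < c) : IsProbabilityMeasure (gibbs d c) :=
  isProbabilityMeasure_tilted (integrable_exp_neg_mul_norm_sq hc)

lemma ac_gibbs_iff (hc : 0 < c) {μ : Measure (Euc d)} :
    μ ≪ gibbs d c ↔ μ ≪ (volume : Measure (Euc d)) :=
  ⟨fun h => h.trans (tilted_absolutelyContinuous _ _),
    fun h => h.trans (absolutelyContinuous_tilted (integrable_exp_neg_mul_norm_sq hc))⟩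

lemma Ent_eq_top_of_klDiv_gibbs (hc : 0 < c) {μ : Measure (Euc d)} (hμ : IsP2 μ)
    (h : klDiv μ (gibbs d c) = ∞) : Ent μ = ⊤ := by
  have := hμ.1
  refine if_neg fun ⟨h1, h2⟩ => klDiv_eq_top_iff.1 h ((ac_gibbs_iff hc).2 h1) ?_
  exact integrable_llr_tilted_right h1 ((hμ.2.const_mul c).neg) h2
    (integrable_exp_neg_mul_norm_sq hc)

lemma Ent_eq_of_klDiv_gibbs (hc : 0 < c) {μ : Measure (Euc d)} (hμ : IsP2 μ)
    (h : klDiv μ (gibbs d c) ≠ ∞) :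
    Ent μ = (((klDiv μ (gibbs d c)).toReal - c * ∫ x, ‖x‖ ^ 2 ∂μ - gibbsLog d c : ℝ) : EReal) := by
  have := hμ.1
  have := isProbabilityMeasure_gibbs (d := d) hc
  obtain ⟨h1, h2⟩ := klDiv_ne_top_iff.1 h
  have h1' := (ac_gibbs_iff hc).1 h1
  have hexp := integrable_exp_neg_mul_norm_sq (d := d) hc
  have i0 : Integrable (fun x : Euc d => c * ‖x‖ ^ 2) μ := hμ.2.const_mul c
  have h3 : Integrable (llr μ volume) μ := by
    refine ((h2.sub i0).sub (integrable_const (gibbsLog d c))).congr ?_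
    filter_upwards [llr_tilted_right h1' hexp] with x hx
    simp only [Pi.sub_apply, gibbs, gibbsLog]
    rw [hx]
    ring
  have h4 := integral_llr_tilted_right h1' i0.neg hexp h3
  have h5 : ∫ x, (-fun x : Euc d => c * ‖x‖ ^ 2) x ∂μ = -(c * ∫ x, ‖x‖ ^ 2 ∂μ) := by
    rw [← integral_const_mul, ← integral_neg]
    rfl
  rw [Ent, if_pos ⟨h1', h3⟩, toReal_klDiv_of_measure_eq h1 (by simp)]
  rw [h5] at h4
  congr 1
  change ∫ x, llr μ volume x ∂μ = (∫ x, llr μ (volume.tilted (-fun x : Euc d => c * ‖x‖ ^ 2)) x ∂μ)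
    - _ - _
  rw [h4, gibbsLog]
  simp only [Pi.neg_apply]
  ring

section Value

variable {ζ σ : ℝ} {μ : Measure (Euc d)}

lemma add_mul_Ent_eq_top (hζ : 0 < ζ) (hσ : 0 < σ) (hμ : IsP2 μ) (U : ℝ)
    (h : klDiv μ (gibbs d (ζ / (2 * σ))) = ∞) : (U : EReal) + (σ : EReal) * Ent μ = ⊤ := by
  rw [Ent_eq_top_of_klDiv_gibbs (by positivity) hμ h, EReal.coe_mul_top_of_pos hσ]
  exact EReal.coe_add_top _

lemma add_mul_Ent_eq (hζ : 0 < ζ) (hσ : 0 < σ) (hμ : IsP2 μ) (U : ℝ)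
    (h : klDiv μ (gibbs d (ζ / (2 * σ))) ≠ ∞) :
    ((U + ζ / 2 * ∫ x, ‖x‖ ^ 2 ∂μ : ℝ) : EReal) + (σ : EReal) * Ent μ =
      ((U + σ * (klDiv μ (gibbs d (ζ / (2 * σ)))).toReal
        - σ * gibbsLog d (ζ / (2 * σ)) : ℝ) : EReal) := by
  rw [Ent_eq_of_klDiv_gibbs (by positivity) hμ h, ← EReal.coe_mul, ← EReal.coe_add]
  congr 1
  field_simp
  ring

end Value

/-- Finite divergence from a Gaussian controls the second moment. -/
lemma exists_moment_bound (d : ℕ) (hc : 0 < c) :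
    ∃ A : ℝ, ∀ μ : Measure (Euc d), IsProbabilityMeasure μ → klDiv μ (gibbs d c) ≠ ∞ →
      IsP2 μ ∧ ∫ x, ‖x‖ ^ 2 ∂μ ≤ 2 / c * ((klDiv μ (gibbs d c)).toReal + A) := by
  set γ := gibbs d c with hγ
  have : IsProbabilityMeasure γ := isProbabilityMeasure_gibbs hc
  have iexp : Integrable (fun x : Euc d => exp (c / 2 * ‖x‖ ^ 2) - 1) γ := by
    refine Integrable.sub ?_ (integrable_const _)
    rw [hγ, gibbs, integrable_tilted_iff (integrable_exp_neg_mul_norm_sq hc)]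
    refine (integrable_exp_neg_mul_norm_sq (d := d) (half_pos hc)).congr
      (Eventually.of_forall fun x => ?_)
    simp only [smul_eq_mul, ← exp_add]
    congr 1
    ring
  refine ⟨∫ x, (exp (c / 2 * ‖x‖ ^ 2) - 1) ∂γ, fun μ hμ h => ?_⟩
  have hac := (klDiv_ne_top_iff.1 h).1
  have : μ.HaveLebesgueDecomposition γ := Measure.haveLebesgueDecomposition_of_sigmaFinite μ γ
  have ikl := integrable_klFun_rnDeriv_of_klDiv_ne_top h
  have hpt : ∀ x : Euc d, (μ.rnDeriv γ x).toReal * (c / 2 * ‖x‖ ^ 2) ≤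
      klFun (μ.rnDeriv γ x).toReal + (exp (c / 2 * ‖x‖ ^ 2) - 1) := fun x =>
    mul_le_klFun_add_exp ENNReal.toReal_nonneg _
  have i1 : Integrable (fun x : Euc d => (μ.rnDeriv γ x).toReal * (c / 2 * ‖x‖ ^ 2)) γ := by
    refine (ikl.add iexp).mono' ?_ (Eventually.of_forall fun x => ?_)
    · exact ((Measure.measurable_rnDeriv _ _).ennreal_toReal.mul
        (by fun_prop)).aestronglyMeasurable
    · rw [norm_of_nonneg (mul_nonneg ENNReal.toReal_nonneg (by positivity))]
      exact hpt x
  have i2 : Integrable (fun x : Euc d => c / 2 * ‖x‖ ^ 2) μ :=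
    (integrable_rnDeriv_smul_iff hac).1 i1
  have i3 : Integrable (fun x : Euc d => ‖x‖ ^ 2) μ :=
    (i2.const_mul (2 / c)).congr (Eventually.of_forall fun x => by simp only; field_simp)
  refine ⟨⟨hμ, i3⟩, ?_⟩
  have hle := integral_mono i1 (ikl.add iexp) hpt
  rw [integral_add' ikl iexp, ← toReal_klDiv_eq_integral_of_ne_top h] at hle
  have heq : ∫ x, (μ.rnDeriv γ x).toReal * (c / 2 * ‖x‖ ^ 2) ∂γ =
      c / 2 * ∫ x, ‖x‖ ^ 2 ∂μ := by
    rw [← integral_const_mul]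
    exact integral_rnDeriv_smul hac
  rw [heq] at hle
  rw [div_mul_eq_mul_div, le_div_iff₀ hc]
  linarith

lemma exists_isP2_Ent_ne_top (d : ℕ) : ∃ μ : Measure (Euc d), IsP2 μ ∧ Ent μ ≠ ⊤ := by
  have := isProbabilityMeasure_gibbs (d := d) one_pos
  obtain ⟨A, hA⟩ := exists_moment_bound d one_pos
  have h : klDiv (gibbs d 1) (gibbs d 1) ≠ ∞ := by simp
  have hP := (hA _ this h).1
  exact ⟨gibbs d 1, hP, by
    rw [Ent_eq_of_klDiv_gibbs one_pos hP h]
    exact EReal.coe_ne_top _⟩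

/-- Measures with uniformly bounded second moments have a weakly convergent subsequence. -/
lemma exists_subseq_tendsto_integral {μs : ℕ → Measure (Euc d)} (hμs : ∀ n, IsP2 (μs n)) {C : ℝ}
    (hC : ∀ n, ∫ x, ‖x‖ ^ 2 ∂μs n ≤ C) :
    ∃ (μ : Measure (Euc d)) (ns : ℕ → ℕ), IsProbabilityMeasure μ ∧ StrictMono ns ∧
      ∀ (f : Euc d → ℝ) (B : ℝ), Continuous f → (∀ x, |f x| ≤ B) →
        Tendsto (fun n => ∫ x, f x ∂μs (ns n)) atTop (𝓝 (∫ x, f x ∂μ)) := by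
  let P : ℕ → ProbabilityMeasure (Euc d) := fun n => ⟨μs n, (hμs n).1⟩
  have hC0 : 0 ≤ C := (integral_nonneg fun x => by positivity).trans (hC 0)
  have htight : IsTightMeasureSet
      {((μ : ProbabilityMeasure (Euc d)) : Measure (Euc d)) | μ ∈ Set.range P} := by
    rw [isTightMeasureSet_iff_exists_isCompact_measure_compl_le]
    intro ε hε
    rcases eq_or_ne ε ∞ with rfl | hε'
    · exact ⟨∅, isCompact_empty, fun _ _ => le_top⟩
    have he : 0 < ε.toReal := ENNReal.toReal_pos hε.ne' hε'
    set r : ℝ := (C + 1) / ε.toReal with hr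
    have hr0 : 0 < r := by positivity
    refine ⟨Metric.closedBall 0 √r, isCompact_closedBall _ _, ?_⟩
    rintro _ ⟨_, ⟨n, rfl⟩, rfl⟩
    have := (hμs n).1
    have hM := mul_meas_ge_le_integral_of_nonneg (μ := μs n)
      (Eventually.of_forall fun x : Euc d => (by positivity : 0 ≤ ‖x‖ ^ 2)) (hμs n).2 r
    have hsub : (Metric.closedBall (0 : Euc d) √r)ᶜ ⊆ {x | r ≤ ‖x‖ ^ 2} := fun x hx => by
      simp only [Set.mem_compl_iff, mem_closedBall_zero_iff, not_le] at hx
      exact (Real.sqrt_le_iff.1 hx.le).2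
    change μs n _ ≤ ε
    refine (measure_mono hsub).trans ?_
    rw [← ENNReal.ofReal_toReal hε', ← ofReal_measureReal]
    refine ENNReal.ofReal_le_ofReal ?_
    have h1 : r * (μs n).real {x | r ≤ ‖x‖ ^ 2} ≤ r * ε.toReal := by
      have : r * ε.toReal = C + 1 := by rw [hr]; field_simp
      linarith [hC n]
    exact le_of_mul_le_mul_left h1 hr0
  obtain ⟨μ, -, ns, hns, ht⟩ := (isCompact_closure_of_isTightMeasureSet htight).tendsto_subseq
    (fun n => subset_closure (Set.mem_range_self n))
  refine ⟨μ, ns, inferInstance, hns, fun f B hf hB => ?_⟩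
  exact ProbabilityMeasure.tendsto_iff_forall_integral_tendsto.1 ht
    (BoundedContinuousFunction.ofNormedAddCommGroup f hf B hB)

end Gibbs

section FeatureMean

variable {m n : ℕ} {Ψ : Euc m → Euc n → ℝ} {R : ℝ}

/-- The mean `∫ Ψ a x dμ(x)` of a feature map under `μ`. -/
def featureMean (Ψ : Euc m → Euc n → ℝ) (μ : Measure (Euc n)) (a : Euc m) : ℝ := ∫ x, Ψ a x ∂μ

lemma measurable_featureMean (hΨ : Measurable (Function.uncurry Ψ)) (μ : Measure (Euc n))
    [SFinite μ] : Measurable (featureMean Ψ μ) :=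
  (StronglyMeasurable.integral_prod_right (f := Ψ) hΨ.stronglyMeasurable).measurable

lemma abs_featureMean_le (hb : ∀ a x, |Ψ a x| ≤ R) (μ : Measure (Euc n)) [IsProbabilityMeasure μ]
    (a : Euc m) : |featureMean Ψ μ a| ≤ R := by
  simpa [featureMean] using
    norm_integral_le_of_norm_le_const (μ := μ) (f := Ψ a) (Eventually.of_forall (hb a))

lemma featureMean_midMeasure (hΨ : Measurable (Function.uncurry Ψ)) (hb : ∀ a x, |Ψ a x| ≤ R)
    (μ ν : Measure (Euc n)) [IsProbabilityMeasure μ] [IsProbabilityMeasure ν] (a : Euc m) :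
    featureMean Ψ (midMeasure μ ν) a = (featureMean Ψ μ a + featureMean Ψ ν a) / 2 := by
  have hm : Measurable (Ψ a) := hΨ.comp measurable_prodMk_left
  exact integral_midMeasure
    (Integrable.of_bound hm.aestronglyMeasurable R (Eventually.of_forall fun x => hb a x))
    (Integrable.of_bound hm.aestronglyMeasurable R (Eventually.of_forall fun x => hb a x))

end FeatureMean

section BoundedMeasurable

variable {Ω : Type*} [MeasurableSpace Ω] {ρ : Measure Ω} [IsProbabilityMeasure ρ]
  {S S' h h' y : Ω → ℝ} {R M : ℝ}

lemma integrable_mul_of_abs_le {f g : Ω → ℝ} {A B : ℝ} (hf : Measurable f) (hg : Measurable g)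
    (hfA : ∀ᵐ p ∂ρ, |f p| ≤ A) (hgB : ∀ᵐ p ∂ρ, |g p| ≤ B) :
    Integrable (fun p => f p * g p) ρ := by
  refine Integrable.of_bound (hf.mul hg).aestronglyMeasurable (A * B) ?_
  filter_upwards [hfA, hgB] with p h1 h2
  rw [norm_mul]
  exact mul_le_mul h1 h2 (norm_nonneg _) ((abs_nonneg _).trans h1)

lemma integral_sq_sub_le_of_midpoint (hS : Measurable S) (hS' : Measurable S')
    (hh : Measurable h) (hh' : Measurable h') (bS : ∀ p, |S p| ≤ R) (bS' : ∀ p, |S' p| ≤ R)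
    (bh : ∀ p, |h p| ≤ R) (bh' : ∀ p, |h' p| ≤ R)
    (hle : ∫ p, (S p - h p) ^ 2 ∂ρ + ∫ p, (S' p - h' p) ^ 2 ∂ρ ≤
      ∫ p, ((S p + S' p) / 2 - h p) ^ 2 ∂ρ + ∫ p, ((S p + S' p) / 2 - h' p) ^ 2 ∂ρ) :
    ∫ p, (S p - S' p) ^ 2 ∂ρ ≤ 4 * R * ∫ p, |h p - h' p| ∂ρ := by
  have isq : ∀ f : Ω → ℝ, Measurable f → (∀ p, |f p| ≤ 2 * R) →
      Integrable (fun p => f p ^ 2) ρ := fun f hf hb => by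
    simp_rw [sq]
    exact integrable_mul_of_abs_le hf hf (Eventually.of_forall hb) (Eventually.of_forall hb)
  have i1 := isq (fun p => S p - h p) (hS.sub hh) fun p => by
    linarith [abs_sub (S p) (h p), bS p, bh p]
  have i2 := isq (fun p => S' p - h' p) (hS'.sub hh') fun p => by
    linarith [abs_sub (S' p) (h' p), bS' p, bh' p]
  have bm : ∀ p, |(S p + S' p) / 2| ≤ R := fun p => by
    rw [abs_div, abs_two]
    linarith [abs_add_le (S p) (S' p), bS p, bS' p]
  have i3 := isq (fun p => (S p + S' p) / 2 - h p) (((hS.add hS').div_const 2).sub hh) fun p => by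
    linarith [abs_sub ((S p + S' p) / 2) (h p), bm p, bh p]
  have i4 := isq (fun p => (S p + S' p) / 2 - h' p) (((hS.add hS').div_const 2).sub hh')
    fun p => by linarith [abs_sub ((S p + S' p) / 2) (h' p), bm p, bh' p]
  have bD : ∀ p, |S p - S' p| ≤ 2 * R := fun p => by
    linarith [abs_sub (S p) (S' p), bS p, bS' p]
  have i5 := isq (fun p => S p - S' p) (hS.sub hS') bD
  have i6 : Integrable (fun p => |h p - h' p|) ρ :=
    Integrable.of_bound (hh.sub hh').abs.aestronglyMeasurable (2 * R)
      (Eventually.of_forall fun p => by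
        rw [norm_eq_abs, abs_abs]
        linarith [abs_sub (h p) (h' p), bh p, bh' p])
  have i7 : Integrable (fun p => (S p - h p) ^ 2 + (S' p - h' p) ^ 2) ρ := i1.add i2
  have i8 : Integrable (fun p => ((S p + S' p) / 2 - h p) ^ 2 + ((S p + S' p) / 2 - h' p) ^ 2) ρ :=
    i3.add i4
  have i9 : Integrable (fun p => (S p - h p) ^ 2 + (S' p - h' p) ^ 2
      - (((S p + S' p) / 2 - h p) ^ 2 + ((S p + S' p) / 2 - h' p) ^ 2)) ρ := i7.sub i8
  rw [← integral_add i1 i2, ← integral_add i3 i4] at hle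
  have hkey : ∫ p, (S p - S' p) ^ 2 ∂ρ ≤ ∫ p, (2 * (((S p - h p) ^ 2 + (S' p - h' p) ^ 2)
      - (((S p + S' p) / 2 - h p) ^ 2 + ((S p + S' p) / 2 - h' p) ^ 2))
      + 4 * R * |h p - h' p|) ∂ρ := by
    refine integral_mono i5 ((i9.const_mul 2).add (i6.const_mul _)) fun p => ?_
    have h1 : (h p - h' p) * (S p - S' p) ≤ |h p - h' p| * (2 * R) :=
      (le_abs_self _).trans (by
        rw [abs_mul]
        exact mul_le_mul_of_nonneg_left (bD p) (abs_nonneg _))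
    simp only
    nlinarith
  rw [integral_add (i9.const_mul 2) (i6.const_mul _), integral_const_mul, integral_const_mul,
    integral_sub i7 i8] at hkey
  linarith

lemma abs_integral_sq_sub_sub_le (hS : Measurable S) (hS' : Measurable S') (hy : Measurable y)
    (bS : ∀ p, |S p| ≤ R) (bS' : ∀ p, |S' p| ≤ R) (by_le : ∀ᵐ p ∂ρ, |y p| ≤ M)
    {η : ℝ} (hη : 0 < η) :
    |(∫ p, (S p - y p) ^ 2 ∂ρ) - ∫ p, (S' p - y p) ^ 2 ∂ρ| ≤
      2 * (R + M) * (1 / (2 * η) * ∫ p, (S p - S' p) ^ 2 ∂ρ + η / 2) := by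
  have isq : ∀ T : Ω → ℝ, Measurable T → (∀ p, |T p| ≤ R) →
      Integrable (fun p => (T p - y p) ^ 2) ρ := fun T hT hb => by
    simp_rw [sq]
    have : ∀ᵐ p ∂ρ, |T p - y p| ≤ R + M := by
      filter_upwards [by_le] with p hp
      linarith [abs_sub (T p) (y p), hb p]
    exact integrable_mul_of_abs_le (hT.sub hy) (hT.sub hy) this this
  have bD : ∀ᵐ p ∂ρ, |S p - S' p| ≤ 2 * R := Eventually.of_forall fun p => by
    linarith [abs_sub (S p) (S' p), bS p, bS' p]
  have i5 : Integrable (fun p => (S p - S' p) ^ 2) ρ := by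
    simp_rw [sq]
    exact integrable_mul_of_abs_le (hS.sub hS') (hS.sub hS') bD bD
  rw [← integral_sub (isq S hS bS) (isq S' hS' bS')]
  refine abs_integral_le_integral_abs.trans ?_
  have e : 2 * (R + M) * (1 / (2 * η) * ∫ p, (S p - S' p) ^ 2 ∂ρ + η / 2) =
      ∫ p, 2 * (R + M) * (1 / (2 * η) * (S p - S' p) ^ 2 + η / 2) ∂ρ := by
    rw [integral_const_mul, integral_add (i5.const_mul _) (integrable_const _),
      integral_const_mul]
    simp
  rw [e]
  refine integral_mono_ae ((isq S hS bS).sub (isq S' hS' bS')).abs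
    (((i5.const_mul _).add (integrable_const _)).const_mul _) ?_
  filter_upwards [by_le] with p hp
  have h1 : (S p - y p) ^ 2 - (S' p - y p) ^ 2 = (S p + S' p - 2 * y p) * (S p - S' p) := by ring
  have h2 : |S p + S' p - 2 * y p| ≤ 2 * (R + M) := by
    have := bS p; have := bS' p
    rw [abs_le] at *
    constructor <;> linarith
  have h3 : |S p - S' p| ≤ 1 / (2 * η) * (S p - S' p) ^ 2 + η / 2 := by
    rw [← sq_abs (S p - S' p)]
    have : 0 ≤ 1 / (2 * η) * (|S p - S' p| - η) ^ 2 := by positivity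
    have e2 : 1 / (2 * η) * (|S p - S' p| - η) ^ 2 =
        1 / (2 * η) * |S p - S' p| ^ 2 + η / 2 - |S p - S' p| := by
      field_simp
      ring
    linarith
  rw [h1, abs_mul]
  exact mul_le_mul h2 h3 (abs_nonneg _) ((abs_nonneg _).trans h2)

end BoundedMeasurable

section FeatureDist

variable {m n : ℕ} {β : Type*} [MeasurableSpace β] {Ψ : Euc m → Euc n → ℝ} {R : ℝ}
  {ρ : Measure (Euc m × β)}

/-- The `L¹(ρ)` distance between the feature means of two measures. -/
def featureDist (ρ : Measure (Euc m × β)) (Ψ : Euc m → Euc n → ℝ) (μ ν : Measure (Euc n)) : ℝ :=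
  ∫ p, |featureMean Ψ μ p.1 - featureMean Ψ ν p.1| ∂ρ

lemma featureDist_nonneg (μ ν : Measure (Euc n)) : 0 ≤ featureDist ρ Ψ μ ν :=
  integral_nonneg fun _ => abs_nonneg _

variable [IsProbabilityMeasure ρ]

lemma integrable_abs_featureMean_sub (hΨ : Measurable (Function.uncurry Ψ))
    (hb : ∀ a x, |Ψ a x| ≤ R) (μ ν : Measure (Euc n)) [IsProbabilityMeasure μ]
    [IsProbabilityMeasure ν] :
    Integrable (fun p : Euc m × β => |featureMean Ψ μ p.1 - featureMean Ψ ν p.1|) ρ := by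
  refine Integrable.of_bound (((measurable_featureMean hΨ μ).comp measurable_fst).sub
    ((measurable_featureMean hΨ ν).comp measurable_fst)).abs.aestronglyMeasurable (R + R)
    (Eventually.of_forall fun p => ?_)
  rw [norm_eq_abs, abs_abs]
  exact (abs_sub _ _).trans (add_le_add (abs_featureMean_le hb μ _) (abs_featureMean_le hb ν _))

lemma featureDist_triangle_right (hΨ : Measurable (Function.uncurry Ψ))
    (hb : ∀ a x, |Ψ a x| ≤ R) (μ ν τ : Measure (Euc n)) [IsProbabilityMeasure μ]
    [IsProbabilityMeasure ν] [IsProbabilityMeasure τ] :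
    featureDist ρ Ψ μ ν ≤ featureDist ρ Ψ μ τ + featureDist ρ Ψ ν τ := by
  unfold featureDist
  rw [← integral_add (integrable_abs_featureMean_sub hΨ hb μ τ)
    (integrable_abs_featureMean_sub hΨ hb ν τ)]
  refine integral_mono (integrable_abs_featureMean_sub hΨ hb μ ν)
    ((integrable_abs_featureMean_sub hΨ hb μ τ).add (integrable_abs_featureMean_sub hΨ hb ν τ))
    fun p => ?_
  simp only
  rw [abs_sub_comm (featureMean Ψ ν p.1)]
  exact abs_sub_le _ _ _

lemma featureDist_midMeasure_le (hΨ : Measurable (Function.uncurry Ψ))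
    (hb : ∀ a x, |Ψ a x| ≤ R) (μ ν τ : Measure (Euc n)) [IsProbabilityMeasure μ]
    [IsProbabilityMeasure ν] [IsProbabilityMeasure τ] :
    featureDist ρ Ψ (midMeasure μ ν) τ ≤ (featureDist ρ Ψ μ τ + featureDist ρ Ψ ν τ) / 2 := by
  unfold featureDist
  rw [← integral_add (integrable_abs_featureMean_sub hΨ hb μ τ)
    (integrable_abs_featureMean_sub hΨ hb ν τ), ← integral_div]
  refine integral_mono (integrable_abs_featureMean_sub hΨ hb _ τ)
    (((integrable_abs_featureMean_sub hΨ hb μ τ).add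
      (integrable_abs_featureMean_sub hΨ hb ν τ)).div_const 2) fun p => ?_
  simp only
  rw [featureMean_midMeasure hΨ hb, le_div_iff₀ two_pos, ← abs_two (α := ℝ), ← abs_mul, abs_two]
  refine le_trans (le_of_eq ?_) (abs_add_le _ _)
  congr 1
  ring

lemma tendsto_featureDist (hΨ : Measurable (Function.uncurry Ψ)) (hb : ∀ a x, |Ψ a x| ≤ R)
    {μs : ℕ → Measure (Euc n)} (hμs : ∀ k, IsProbabilityMeasure (μs k)) (μ τ : Measure (Euc n))
    [IsProbabilityMeasure τ]
    (h : ∀ a, Tendsto (fun k => featureMean Ψ (μs k) a) atTop (𝓝 (featureMean Ψ μ a))) :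
    Tendsto (fun k => featureDist ρ Ψ (μs k) τ) atTop (𝓝 (featureDist ρ Ψ μ τ)) := by
  refine tendsto_integral_of_dominated_convergence (fun _ => R + R)
    (fun k => (integrable_abs_featureMean_sub hΨ hb (μs k) τ).aestronglyMeasurable)
    (integrable_const _) (fun k => Eventually.of_forall fun p => ?_)
    (Eventually.of_forall fun p => ((h p.1).sub_const _).abs)
  rw [norm_eq_abs, abs_abs]
  exact (abs_sub _ _).trans
    (add_le_add (abs_featureMean_le hb (μs k) _) (abs_featureMean_le hb τ _))

end FeatureDist

section StageOne

variable {da dw dx dz : ℕ} {ρ : Measure (Euc da × Euc dw × ℝ)} {ΨA : Euc da → Euc dx → ℝ}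
  {ΨW : Euc dw → Euc dz → ℝ} {sel : Measure (Euc dx) → Measure (Euc dz)} {R M ζ σ : ℝ}

lemma U2_nonneg (μz : Measure (Euc dz)) : 0 ≤ U2 ρ ΨW μz :=
  mul_nonneg (by norm_num) (integral_nonneg fun _ => sq_nonneg _)

lemma calF1_eq (hζ : 0 < ζ) (hσ : 0 < σ) (μx : Measure (Euc dx)) {μz : Measure (Euc dz)}
    (hμz : IsP2 μz) (h : klDiv μz (gibbs dz (ζ / (2 * σ))) ≠ ∞) :
    calF1 ρ ΨA ΨW ζ σ μx μz = ((U1 ρ ΨA ΨW μx μz + σ * (klDiv μz (gibbs dz (ζ / (2 * σ)))).toReal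
      - σ * gibbsLog dz (ζ / (2 * σ)) : ℝ) : EReal) :=
  add_mul_Ent_eq hζ hσ hμz _ h

lemma calF2_eq (hζ : 0 < ζ) (hσ : 0 < σ) {μx : Measure (Euc dx)} (μz : Measure (Euc dz))
    (hμx : IsP2 μx) (h : klDiv μx (gibbs dx (ζ / (2 * σ))) ≠ ∞) :
    calF2 ρ ΨW ζ σ μx μz = ((U2 ρ ΨW μz + σ * (klDiv μx (gibbs dx (ζ / (2 * σ)))).toReal
      - σ * gibbsLog dx (ζ / (2 * σ)) : ℝ) : EReal) :=
  add_mul_Ent_eq hζ hσ hμx _ h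

lemma klDiv_ne_top_of_isStageOneSel (hζ : 0 < ζ) (hσ : 0 < σ)
    (hsel : IsStageOneSel ρ ΨA ΨW ζ σ sel) {μ : Measure (Euc dx)} (hμ : IsP2 μ) :
    klDiv (sel μ) (gibbs dz (ζ / (2 * σ))) ≠ ∞ := fun h =>
  (hsel μ hμ).2.1 (add_mul_Ent_eq_top hζ hσ (hsel μ hμ).1 _ h)

lemma U1_sel_le (hζ : 0 < ζ) (hσ : 0 < σ) (hsel : IsStageOneSel ρ ΨA ΨW ζ σ sel)
    {μ : Measure (Euc dx)} (hμ : IsP2 μ) {ν : Measure (Euc dz)} (hν : IsP2 ν)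
    (h : klDiv ν (gibbs dz (ζ / (2 * σ))) ≠ ∞) :
    U1 ρ ΨA ΨW μ (sel μ) + σ * (klDiv (sel μ) (gibbs dz (ζ / (2 * σ)))).toReal ≤
      U1 ρ ΨA ΨW μ ν + σ * (klDiv ν (gibbs dz (ζ / (2 * σ)))).toReal := by
  have hle := (hsel μ hμ).2.2.2 ν hν
  rw [calF1_eq hζ hσ μ (hsel μ hμ).1 (klDiv_ne_top_of_isStageOneSel hζ hσ hsel hμ),
    calF1_eq hζ hσ μ hν h, EReal.coe_le_coe_iff] at hle
  linarith

/-- The Stage-II loss of a Stage-I selection depends continuously on the feature means. -/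
lemma abs_U2_sel_sub_le [IsProbabilityMeasure ρ] (hζ : 0 < ζ) (hσ : 0 < σ) (hA1 : A1 ρ M)
    (hA2 : A2 ΨA ΨW R) (hsel : IsStageOneSel ρ ΨA ΨW ζ σ sel) (hRM : 0 ≤ R + M)
    {μ μ' : Measure (Euc dx)}
    (hμ : IsP2 μ) (hμ' : IsP2 μ') {η : ℝ} (hη : 0 < η) :
    |U2 ρ ΨW (sel μ) - U2 ρ ΨW (sel μ')| ≤ (R + M) *
      (2 * R / η * featureDist ρ ΨA μ μ' + η / 2) := by
  obtain ⟨mA, mW, bA, bW, -⟩ := hA2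
  have hν := (hsel μ hμ).1
  have hν' := (hsel μ' hμ').1
  have pμ := hμ.1
  have pμ' := hμ'.1
  have pν := hν.1
  have pν' := hν'.1
  have pγ := isProbabilityMeasure_gibbs (d := dz) (c := ζ / (2 * σ)) (by positivity)
  have k := klDiv_ne_top_of_isStageOneSel hζ hσ hsel hμ
  have k' := klDiv_ne_top_of_isStageOneSel hζ hσ hsel hμ'
  obtain ⟨km, -, hkm⟩ := klDiv_midMeasure k k'
  have hkm' := le_trans (le_add_of_nonneg_right (mul_nonneg (by norm_num)
    (integral_nonneg fun _ => sq_nonneg _))) hkm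
  have hmid : IsP2 (midMeasure (sel μ) (sel μ')) :=
    ⟨inferInstance, integrable_midMeasure hν.2 hν'.2⟩
  have l1 := U1_sel_le hζ hσ hsel hμ hmid km
  have l2 := U1_sel_le hζ hσ hsel hμ' hmid km
  have hsum : U1 ρ ΨA ΨW μ (sel μ) + U1 ρ ΨA ΨW μ' (sel μ') ≤
      U1 ρ ΨA ΨW μ (midMeasure (sel μ) (sel μ')) +
        U1 ρ ΨA ΨW μ' (midMeasure (sel μ) (sel μ')) := by
    nlinarith [mul_le_mul_of_nonneg_left hkm' hσ.le]
  have hU1 : ∀ (τ : Measure (Euc dx)) (ν : Measure (Euc dz)), U1 ρ ΨA ΨW τ ν =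
      1 / 2 * ∫ p, (featureMean ΨW ν p.2.1 - featureMean ΨA τ p.1) ^ 2 ∂ρ := fun _ _ => rfl
  simp only [hU1, featureMean_midMeasure mW bW] at hsum
  have key := integral_sq_sub_le_of_midpoint (ρ := ρ)
    (S := fun p => featureMean ΨW (sel μ) p.2.1) (S' := fun p => featureMean ΨW (sel μ') p.2.1)
    (h := fun p => featureMean ΨA μ p.1) (h' := fun p => featureMean ΨA μ' p.1)
    ((measurable_featureMean mW _).comp (measurable_fst.comp measurable_snd))
    ((measurable_featureMean mW _).comp (measurable_fst.comp measurable_snd))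
    ((measurable_featureMean mA _).comp measurable_fst)
    ((measurable_featureMean mA _).comp measurable_fst)
    (fun p => abs_featureMean_le bW _ _) (fun p => abs_featureMean_le bW _ _)
    (fun p => abs_featureMean_le bA _ _) (fun p => abs_featureMean_le bA _ _) (by linarith)
  have hU := abs_integral_sq_sub_sub_le (ρ := ρ) (y := fun p => p.2.2)
    (S := fun p => featureMean ΨW (sel μ) p.2.1) (S' := fun p => featureMean ΨW (sel μ') p.2.1)
    ((measurable_featureMean mW _).comp (measurable_fst.comp measurable_snd))
    ((measurable_featureMean mW _).comp (measurable_fst.comp measurable_snd))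
    (measurable_snd.comp measurable_snd)
    (fun p => abs_featureMean_le bW _ _) (fun p => abs_featureMean_le bW _ _) hA1 hη
  have hU2 : ∀ ν : Measure (Euc dz), U2 ρ ΨW ν =
      1 / 2 * ∫ p, (featureMean ΨW ν p.2.1 - p.2.2) ^ 2 ∂ρ := fun _ => rfl
  rw [hU2, hU2, ← mul_sub, abs_mul, abs_of_pos (by norm_num : (0 : ℝ) < 1 / 2)]
  refine (mul_le_mul_of_nonneg_left hU (by norm_num)).trans ?_
  rw [← mul_assoc, ← mul_assoc, show (1 / 2 * 2 : ℝ) = 1 by norm_num, one_mul]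
  refine mul_le_mul_of_nonneg_left (add_le_add_left ?_ _) hRM
  refine (mul_le_mul_of_nonneg_left key (by positivity)).trans (le_of_eq ?_)
  rw [featureDist]
  field_simp
  ring

/-- Convergence of the feature means in `L¹(ρ)` forces the Stage-II losses to be close. -/
lemma exists_delta_U2_sel [IsProbabilityMeasure ρ] (hζ : 0 < ζ) (hσ : 0 < σ) (hA1 : A1 ρ M)
    (hA2 : A2 ΨA ΨW R) (hsel : IsStageOneSel ρ ΨA ΨW ζ σ sel) (hR : 0 < R) (hM : 0 < M)
    {ε : ℝ} (hε : 0 < ε) :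
    ∃ δ > 0, ∀ μ μ' : Measure (Euc dx), IsP2 μ → IsP2 μ' →
      featureDist ρ ΨA μ μ' ≤ δ →
      |U2 ρ ΨW (sel μ) - U2 ρ ΨW (sel μ')| ≤ ε := by
  set η := ε / (R + M) with hηdef
  have hη : 0 < η := by positivity
  refine ⟨η ^ 2 / (4 * R), by positivity, fun μ μ' hμ hμ' hle => ?_⟩
  refine (abs_U2_sel_sub_le hζ hσ hA1 hA2 hsel (by positivity) hμ hμ' hη).trans ?_
  have h1 : 2 * R / η * featureDist ρ ΨA μ μ' ≤ η / 2 := by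
    refine (mul_le_mul_of_nonneg_left hle (by positivity)).trans (le_of_eq ?_)
    field_simp
    norm_num
  calc _ ≤ (R + M) * (η / 2 + η / 2) := by gcongr
    _ = ε := by rw [add_halves, hηdef]; field_simp

end StageOne

section StageTwo

variable {da dw dx dz : ℕ} {ρ : Measure (Euc da × Euc dw × ℝ)} {ΨA : Euc da → Euc dx → ℝ}
  {ΨW : Euc dw → Euc dz → ℝ} {sel : Measure (Euc dx) → Measure (Euc dz)} {R M ζ1 ζ2 σ1 σ2 : ℝ}

/-- From a sequence with bounded divergences one extracts a measure whose divergence and feature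
means are both limits along a subsequence. -/
lemma exists_klDiv_le_tendsto_featureDist [IsProbabilityMeasure ρ] {c : ℝ} (hc : 0 < c)
    (hΨ : Measurable (Function.uncurry ΨA)) (hb : ∀ a x, |ΨA a x| ≤ R)
    (hcont : ∀ a, Continuous (ΨA a)) {μs : ℕ → Measure (Euc dx)} {B : ℝ}
    (hP : ∀ n, IsP2 (μs n)) (hkl : ∀ n, klDiv (μs n) (gibbs dx c) ≠ ∞)
    (hB : ∀ n, (klDiv (μs n) (gibbs dx c)).toReal ≤ B) :
    ∃ (μ : Measure (Euc dx)) (ns : ℕ → ℕ) (L : ℝ), IsP2 μ ∧ StrictMono ns ∧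
      klDiv μ (gibbs dx c) ≠ ∞ ∧ (klDiv μ (gibbs dx c)).toReal ≤ L ∧
      Tendsto (fun n => (klDiv (μs (ns n)) (gibbs dx c)).toReal) atTop (𝓝 L) ∧
      Tendsto (fun n => featureDist ρ ΨA (μs (ns n)) μ) atTop (𝓝 0) := by
  have pγ := isProbabilityMeasure_gibbs (d := dx) hc
  obtain ⟨A, hA⟩ := exists_moment_bound dx hc
  obtain ⟨τ, ns, hτ, hns, hweak⟩ := exists_subseq_tendsto_integral hP
    (C := 2 / c * (B + A)) fun n => ((hA _ (hP n).1 (hkl n)).2).trans (by gcongr; exact hB n)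
  obtain ⟨L, -, ms, hms, hL⟩ := (isCompact_Icc (a := (0 : ℝ)) (b := B)).tendsto_subseq
    (x := fun n => (klDiv (μs (ns n)) (gibbs dx c)).toReal)
    fun n => ⟨ENNReal.toReal_nonneg, hB _⟩
  have hdist : Tendsto (fun n => featureDist ρ ΨA (μs (ns (ms n))) τ) atTop (𝓝 0) := by
    have h := tendsto_featureDist (ρ := ρ) hΨ hb (fun n => (hP (ns (ms n))).1) τ τ
      fun a => (hweak (ΨA a) R (hcont a) (hb a)).comp hms.tendsto_atTop
    simpa [featureDist] using h
  let K : ℕ → Set (Measure (Euc dx)) := fun n =>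
    {ν | IsProbabilityMeasure ν ∧ featureDist ρ ΨA ν τ ≤ 1 / ((n : ℝ) + 1)}
  have hKanti : Antitone K := fun n m hnm ν hν =>
    ⟨hν.1, hν.2.trans (one_div_le_one_div_of_le (by positivity) (by gcongr))⟩
  obtain ⟨μ, νs, hνs, hμ, hk, hkL, hφ⟩ := exists_limit_of_antitone_midConvex
    (γ := gibbs dx c) hKanti (fun n ν hν => hν.1)
    (fun n ν hν ν' hν' => by
      have := hν.1
      have := hν'.1
      refine ⟨inferInstance, (featureDist_midMeasure_le hΨ hb ν ν' τ).trans ?_⟩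
      linarith [hν.2, hν'.2])
    (L := L) (fun n ε hε => by
      have h1 := hdist.eventually (ge_mem_nhds (show (0 : ℝ) < 1 / ((n : ℝ) + 1) by positivity))
      have h2 := hL.eventually (ge_mem_nhds (show L < L + ε by linarith))
      obtain ⟨j, hj1, hj2⟩ := (h1.and h2).exists
      exact ⟨_, ⟨(hP _).1, hj1⟩, hkl _, hj2⟩)
  have hμτ : featureDist ρ ΨA μ τ ≤ 0 := by
    refine le_of_tendsto_of_tendsto' (tendsto_featureDist (ρ := ρ) hΨ hb (fun n => (hνs n).1) μ τ
      fun a => hφ (ΨA a) R (hΨ.comp measurable_prodMk_left) (hb a))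
      tendsto_one_div_add_atTop_nhds_zero_nat fun n => (hνs n).2
  refine ⟨μ, ns ∘ ms, L, (hA μ hμ hk).1, hns.comp hms, hk, hkL, hL, ?_⟩
  refine squeeze_zero (fun _ => featureDist_nonneg _ _) (fun n => ?_) hdist
  have := (hP (ns (ms n))).1
  exact (featureDist_triangle_right hΨ hb (μs (ns (ms n))) μ τ).trans
    (add_le_of_nonpos_right hμτ)

lemma exists_minimizer_U2_sel_add_klDiv [IsProbabilityMeasure ρ] (hR : 0 < R) (hM : 0 < M)
    (hζ1 : 0 < ζ1) (hσ1 : 0 < σ1) (hσ2 : 0 < σ2) (hA1 : A1 ρ M) (hA2 : A2 ΨA ΨW R)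
    (hsel : IsStageOneSel ρ ΨA ΨW ζ1 σ1 sel) {c : ℝ} (hc : 0 < c) :
    ∃ μ : Measure (Euc dx), IsP2 μ ∧ klDiv μ (gibbs dx c) ≠ ∞ ∧
      ∀ μ', IsP2 μ' → klDiv μ' (gibbs dx c) ≠ ∞ →
        U2 ρ ΨW (sel μ) + σ2 * (klDiv μ (gibbs dx c)).toReal ≤
          U2 ρ ΨW (sel μ') + σ2 * (klDiv μ' (gibbs dx c)).toReal := by
  set G : Measure (Euc dx) → ℝ := fun μ =>
    U2 ρ ΨW (sel μ) + σ2 * (klDiv μ (gibbs dx c)).toReal with hG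
  set V : Set ℝ := G '' {μ | IsP2 μ ∧ klDiv μ (gibbs dx c) ≠ ∞} with hV
  have hbdd : BddBelow V := ⟨0, by
    rintro _ ⟨μ, -, rfl⟩
    exact add_nonneg (U2_nonneg _) (mul_nonneg hσ2.le ENNReal.toReal_nonneg)⟩
  have hne : V.Nonempty := by
    obtain ⟨μ, hμ, hE⟩ := exists_isP2_Ent_ne_top dx
    exact ⟨_, μ, ⟨hμ, fun h => hE (Ent_eq_top_of_klDiv_gibbs hc hμ h)⟩, rfl⟩
  have hex : ∀ n : ℕ, ∃ μ, (IsP2 μ ∧ klDiv μ (gibbs dx c) ≠ ∞) ∧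
      G μ < sInf V + 1 / ((n : ℝ) + 1) := fun n => by
    obtain ⟨_, ⟨μ, hμ, rfl⟩, hlt⟩ := exists_lt_of_csInf_lt hne
      (lt_add_of_pos_right (sInf V) (show (0 : ℝ) < 1 / ((n : ℝ) + 1) by positivity))
    exact ⟨μ, hμ, hlt⟩
  choose μs hμs hlt using hex
  obtain ⟨μ, ns, L, hμ, hns, hk, hkL, hL, hdist⟩ := exists_klDiv_le_tendsto_featureDist (ρ := ρ) hc
    hA2.1 hA2.2.2.1 (fun a => (hA2.2.2.2.2.1 a).continuous) (fun n => (hμs n).1)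
    (fun n => (hμs n).2) (B := (sInf V + 1) / σ2) fun n => by
      have h1 : 1 / ((n : ℝ) + 1) ≤ 1 := by
        rw [div_le_one (by positivity)]
        linarith [n.cast_nonneg (α := ℝ)]
      have h2 := hlt n
      simp only [hG] at h2
      rw [le_div_iff₀ hσ2]
      linarith [U2_nonneg (ρ := ρ) (ΨW := ΨW) (sel (μs n))]
  refine ⟨μ, hμ, hk, fun μ' hμ' hk' => ?_⟩
  refine le_trans ?_ (csInf_le hbdd ⟨μ', ⟨hμ', hk'⟩, rfl⟩)
  refine le_of_forall_pos_le_add fun ε hε => ?_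
  obtain ⟨δ, hδ, hclose⟩ := exists_delta_U2_sel hζ1 hσ1 hA1 hA2 hsel hR hM
    (show 0 < ε / 3 by positivity)
  have e1 := hdist.eventually (ge_mem_nhds hδ)
  have e2 := hL.eventually (le_mem_nhds (show L - ε / 3 / σ2 < L from sub_lt_self _ (by positivity)))
  have e3 := (tendsto_one_div_add_atTop_nhds_zero_nat (𝕜 := ℝ)).comp hns.tendsto_atTop |>.eventually
    (ge_mem_nhds (show 0 < ε / 3 by positivity))
  obtain ⟨n, h1, h2, h3⟩ := (e1.and (e2.and e3)).exists
  have h4 := (abs_le.1 (hclose _ _ (hμs (ns n)).1 hμ h1)).1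
  have h5 := hlt (ns n)
  simp only [hG, Function.comp_apply] at h3 h5 ⊢
  have h6 := mul_le_mul_of_nonneg_left (hkL.trans (sub_le_iff_le_add.1 h2)) hσ2.le
  rw [mul_add, mul_div_cancel₀ _ hσ2.ne'] at h6
  linarith

end StageTwo

end Preliminaries

/-- Proposition 4.3, Stage II: existence of a Stage-II minimizer with finite
value, and absolute continuity of every Stage-II minimizer. -/
theorem stmt8
    {da dw dx dz : ℕ} (hda : 0 < da) (hdw : 0 < dw) (hdx : 0 < dx) (hdz : 0 < dz)
    (R M ζ1 ζ2 σ1 σ2 : ℝ)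
    (hR : 0 < R) (hM : 0 < M) (hζ1 : 0 < ζ1) (hζ2 : 0 < ζ2) (hσ1 : 0 < σ1) (hσ2 : 0 < σ2)
    (ρ : Measure (Euc da × Euc dw × ℝ)) (hρ : IsProbabilityMeasure ρ)
    (ΨA : Euc da → Euc dx → ℝ) (ΨW : Euc dw → Euc dz → ℝ)
    (hA1 : A1 ρ M) (hA2 : A2 ΨA ΨW R)
    (sel : Measure (Euc dx) → Measure (Euc dz))
    (hsel : IsStageOneSel ρ ΨA ΨW ζ1 σ1 sel) :
    (∃ μxs : Measure (Euc dx), IsP2 μxs ∧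
      (∀ μx, IsP2 μx → calF2 ρ ΨW ζ2 σ2 μxs (sel μxs) ≤ calF2 ρ ΨW ζ2 σ2 μx (sel μx)) ∧
      calF2 ρ ΨW ζ2 σ2 μxs (sel μxs) ≠ ⊤ ∧ calF2 ρ ΨW ζ2 σ2 μxs (sel μxs) ≠ ⊥) ∧
    (∀ μxs : Measure (Euc dx), IsP2 μxs →
      (∀ μx, IsP2 μx → calF2 ρ ΨW ζ2 σ2 μxs (sel μxs) ≤ calF2 ρ ΨW ζ2 σ2 μx (sel μx)) →
      μxs ≪ (volume : Measure (Euc dx))) := by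
  have hc : 0 < ζ2 / (2 * σ2) := by positivity
  obtain ⟨μ, hμ, hk, hmin⟩ :=
    exists_minimizer_U2_sel_add_klDiv hR hM hζ1 hσ1 hσ2 hA1 hA2 hsel hc
  have hval := calF2_eq (ρ := ρ) (ΨW := ΨW) hζ2 hσ2 (sel μ) hμ hk
  have htop : calF2 ρ ΨW ζ2 σ2 μ (sel μ) ≠ ⊤ := by
    rw [hval]
    exact EReal.coe_ne_top _
  refine ⟨⟨μ, hμ, fun μ' hμ' => ?_, htop, ?_⟩, fun μ' hμ' hmin' => ?_⟩
  · by_cases hk' : InformationTheory.klDiv μ' (gibbs dx (ζ2 / (2 * σ2))) = ∞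
    · exact le_top.trans_eq (add_mul_Ent_eq_top hζ2 hσ2 hμ' _ hk').symm
    · rw [hval, calF2_eq hζ2 hσ2 (sel μ') hμ' hk', EReal.coe_le_coe_iff]
      linarith [hmin μ' hμ' hk']
  · rw [hval]
    exact EReal.coe_ne_bot _
  · have hk' : InformationTheory.klDiv μ' (gibbs dx (ζ2 / (2 * σ2))) ≠ ∞ := fun h =>
      htop (top_le_iff.1 ((add_mul_Ent_eq_top hζ2 hσ2 hμ' _ h).symm.trans_le (hmin' μ hμ)))
    exact (ac_gibbs_iff hc).1 (InformationTheory.klDiv_ne_top_iff.1 hk').1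
end
end

section
/- Assume (A1) and (A2). For every σ̄₁ ≥ 0 and every μ_x ∈ P₂(ℝ^{d_x}), assume there exists, and fix, a minimizer s_{σ̄₁}(μ_x) ∈ P₂(ℝ^{d_z}) of ν ↦ F₁(μ_x, ν) + σ̄₁·Ent(ν) over P₂(ℝ^{d_z}) (with finite value when σ̄₁ > 0). For σ̄₁, σ̄₂ ≥ 0 define G_{σ̄₁,σ̄₂} : P₂(ℝ^{d_x}) → ℝ ∪ {+∞} by G_{σ̄₁,σ̄₂}(μ_x) := U₂(s_{σ̄₁}(μ_x)) + (ζ₂/2)∫‖x‖² dμ_x + σ̄₂·Ent(μ_x). Then G_{σ̄₁,σ̄₂} Γ-converges to G_{0,0} as (σ̄₁, σ̄₂) → (0,0) with respect to the topology of weak convergence of probability measures; that is, for all sequences σ̄₁⁽ⁿ⁾ > 0, σ̄₂⁽ⁿ⁾ > 0 with σ̄₁⁽ⁿ⁾ → 0 and σ̄₂⁽ⁿ⁾ → 0: (i) (liminf inequality) for every μ_x ∈ P₂(ℝ^{d_x}) and every sequence μ_x⁽ⁿ⁾ ∈ P₂(ℝ^{d_x}) converging weakly to μ_x, liminf_n G_{σ̄₁⁽ⁿ⁾,σ̄₂⁽ⁿ⁾}(μ_x⁽ⁿ⁾)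 ≥ G_{0,0}(μ_x); (ii) (recovery sequence) for every μ_x ∈ P₂(ℝ^{d_x}) there exists a sequence μ_x⁽ⁿ⁾ ∈ P₂(ℝ^{d_x}) converging weakly to μ_x with limsup_n G_{σ̄₁⁽ⁿ⁾,σ̄₂⁽ⁿ⁾}(μ_x⁽ⁿ⁾) ≤ G_{0,0}(μ_x). -/
open MeasureTheory ProbabilityTheory Real Filter
open scoped ENNReal Classical

noncomputable section

section Gamma

variable {da dw dx dz : ℕ}

/-- The Stage-I objective with entropic regularization scale `σ̄₁ ≥ 0`. -/
def FEnt (ρ : Measure (Euc da × Euc dw × ℝ)) (ΨA : Euc da → Euc dx → ℝ)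
    (ΨW : Euc dw → Euc dz → ℝ) (ζ1 s1 : ℝ) (μx : Measure (Euc dx))
    (ν : Measure (Euc dz)) : EReal :=
  ((F1 ρ ΨA ΨW ζ1 μx ν : ℝ) : EReal) + (s1 : EReal) * Ent ν

/-- The Stage-II functional `G_{σ̄₁,σ̄₂}(μ_x) = U₂(s_{σ̄₁}(μ_x)) + (ζ₂/2)∫‖x‖²dμ_x + σ̄₂ Ent(μ_x)`. -/
def Gfun (ρ : Measure (Euc da × Euc dw × ℝ)) (ΨA : Euc da → Euc dx → ℝ)
    (ΨW : Euc dw → Euc dz → ℝ) (ζ1 ζ2 : ℝ)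
    (s : ℝ → Measure (Euc dx) → Measure (Euc dz)) (s1 s2 : ℝ)
    (μx : Measure (Euc dx)) : EReal :=
  ((U2 ρ ΨW (s s1 μx) + (ζ2 / 2) * ∫ x, ‖x‖ ^ 2 ∂μx : ℝ) : EReal) + (s2 : EReal) * Ent μx

/-- Weak convergence of probability measures: convergence of integrals of all bounded
continuous functions. -/
def WeakConv {d : ℕ} (μseq : ℕ → Measure (Euc d)) (μ : Measure (Euc d)) : Prop :=
  ∀ f : BoundedContinuousFunction (Euc d) ℝ,
    Tendsto (fun n => ∫ x, f x ∂(μseq n)) atTop (nhds (∫ x, f x ∂μ))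

end Gamma

section Entropy

variable {d : ℕ} {μ : Measure (Euc d)}

lemma integrable_exp_neg_norm_sq (d : ℕ) :
    Integrable (fun x : Euc d => Real.exp (-‖x‖ ^ 2)) := by
  refine Integrable.of_integral_ne_zero ?_
  have h := GaussianFourier.integral_rexp_neg_mul_sq_norm (V := Euc d) one_pos
  simp only [neg_mul, one_mul] at h
  rw [h]
  positivity

lemma integrable_exp_neg_norm_sq_div_rnDeriv [IsFiniteMeasure μ] (hμ : μ ≪ volume) :
    Integrable (fun x => Real.exp (-‖x‖ ^ 2) / (μ.rnDeriv volume x).toReal) μ ∧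
      ∫ x, Real.exp (-‖x‖ ^ 2) / (μ.rnDeriv volume x).toReal ∂μ ≤
        ∫ x : Euc d, Real.exp (-‖x‖ ^ 2) := by
  have hle : ∀ x : Euc d, (μ.rnDeriv volume x).toReal *
      (Real.exp (-‖x‖ ^ 2) / (μ.rnDeriv volume x).toReal) ≤ Real.exp (-‖x‖ ^ 2) := fun x => by
    rcases eq_or_ne (μ.rnDeriv volume x).toReal 0 with h | h
    · simp only [h, zero_mul]; positivity
    · rw [mul_div_cancel₀ _ h]
  have hmeas : Measurable fun x : Euc d => (μ.rnDeriv volume x).toReal :=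
    (Measure.measurable_rnDeriv _ _).ennreal_toReal
  have hint : Integrable (fun x : Euc d => (μ.rnDeriv volume x).toReal *
      (Real.exp (-‖x‖ ^ 2) / (μ.rnDeriv volume x).toReal)) := by
    refine (integrable_exp_neg_norm_sq d).mono' ?_ (ae_of_all _ fun x => ?_)
    · exact (hmeas.mul (Measurable.div (by fun_prop) hmeas)).aestronglyMeasurable
    · rw [Real.norm_of_nonneg (by positivity)]
      exact hle x
  refine ⟨(integrable_toReal_rnDeriv_mul_iff hμ).1 hint, ?_⟩
  rw [← integral_toReal_rnDeriv_mul hμ]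
  exact integral_mono hint (integrable_exp_neg_norm_sq d) hle

lemma neg_log_rnDeriv_le [IsFiniteMeasure μ] (hμ : μ ≪ volume) :
    ∀ᵐ x ∂μ, -Real.log (μ.rnDeriv volume x).toReal ≤
      ‖x‖ ^ 2 + Real.exp (-‖x‖ ^ 2) / (μ.rnDeriv volume x).toReal := by
  filter_upwards [Measure.rnDeriv_pos hμ, hμ.ae_le (Measure.rnDeriv_lt_top μ volume)] with x h0 h1
  have hpos : 0 < (μ.rnDeriv volume x).toReal := ENNReal.toReal_pos h0.ne' h1.ne
  have h := Real.log_le_sub_one_of_pos (div_pos (Real.exp_pos (-‖x‖ ^ 2)) hpos)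
  rw [Real.log_div (Real.exp_pos _).ne' hpos.ne', Real.log_exp] at h
  linarith

/-- The negative entropy is bounded below in terms of the second moment. -/
lemma le_Ent (hμ : IsP2 μ) :
    ((-(∫ x : Euc d, Real.exp (-‖x‖ ^ 2)) - ∫ x, ‖x‖ ^ 2 ∂μ : ℝ) : EReal) ≤ Ent μ := by
  have := hμ.1
  unfold Ent
  split_ifs with h
  · obtain ⟨hac, hlog⟩ := h
    obtain ⟨hint, hle⟩ := integrable_exp_neg_norm_sq_div_rnDeriv hac
    rw [EReal.coe_le_coe_iff]
    have := integral_mono_ae hlog.neg (hμ.2.add hint) (neg_log_rnDeriv_le hac)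
    simp only [Pi.neg_apply, Pi.add_apply] at this
    rw [integral_neg, integral_add hμ.2 hint] at this
    linarith
  · exact le_top

/-- A measure with density at most `K` has negative entropy at most `log K`. -/
lemma Ent_le_log (hμ : IsP2 μ) {K : ℝ} (hK : 0 < K)
    (hle : μ ≤ ENNReal.ofReal K • (volume : Measure (Euc d))) :
    Ent μ ≤ (Real.log K : EReal) := by
  have := hμ.1
  have hac : μ ≪ volume := hle.absolutelyContinuous.trans
    (Measure.smul_absolutelyContinuous)
  have hbd : ∀ᵐ x, μ.rnDeriv volume x ≤ ENNReal.ofReal K := by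
    refine ae_le_of_forall_setLIntegral_le_of_sigmaFinite (Measure.measurable_rnDeriv _ _)
      fun s _ _ => (Measure.setLIntegral_rnDeriv_le s).trans ?_
    simpa using hle s
  have hlog_le : ∀ᵐ x ∂μ, Real.log (μ.rnDeriv volume x).toReal ≤ Real.log K := by
    filter_upwards [Measure.rnDeriv_pos hac, hac.ae_le (Measure.rnDeriv_lt_top μ volume),
      hac.ae_le hbd] with x h0 h1 h2
    exact Real.log_le_log (ENNReal.toReal_pos h0.ne' h1.ne) (ENNReal.toReal_le_of_le_ofReal hK.le h2)
  have hint : Integrable (fun x => Real.log (μ.rnDeriv volume x).toReal) μ := by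
    refine ((integrable_const |Real.log K|).add
      (hμ.2.add (integrable_exp_neg_norm_sq_div_rnDeriv hac).1)).mono' ?_ ?_
    · exact (Real.measurable_log.comp
        (Measure.measurable_rnDeriv _ _).ennreal_toReal).aestronglyMeasurable
    · filter_upwards [hlog_le, neg_log_rnDeriv_le hac] with x h1 h2
      have h3 : 0 ≤ Real.exp (-‖x‖ ^ 2) / (μ.rnDeriv volume x).toReal := by positivity
      have h4 : 0 ≤ ‖x‖ ^ 2 := by positivity
      simp only [Pi.add_apply]
      rw [Real.norm_eq_abs, abs_le]
      constructor <;> linarith [le_abs_self (Real.log K), abs_nonneg (Real.log K)]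
  rw [Ent, if_pos ⟨hac, hint⟩, EReal.coe_le_coe_iff]
  simpa using integral_mono_ae hint (integrable_const _) hlog_le

end Entropy

section Mollify

variable {d : ℕ}

/-- The uniform distribution on the closed unit ball of `ℝ^d`. -/
def unifBall (d : ℕ) : Measure (Euc d) := volume[|Metric.closedBall 0 1]

/-- The law of `X + ε U` for independent `X ∼ μ` and `U` uniform on the unit ball. -/
def mollify (ε : ℝ) (μ : Measure (Euc d)) : Measure (Euc d) :=
  (μ.prod (unifBall d)).map fun p => p.1 + ε • p.2

lemma volume_unitBall_ne_zero : (volume : Measure (Euc d)) (Metric.closedBall 0 1) ≠ 0 :=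
  (Metric.measure_closedBall_pos volume _ one_pos).ne'

instance isProbabilityMeasure_unifBall : IsProbabilityMeasure (unifBall d) :=
  cond_isProbabilityMeasure_of_finite volume_unitBall_ne_zero
    (isCompact_closedBall _ _).measure_lt_top.ne

lemma ae_norm_le_one_unifBall : ∀ᵐ u ∂unifBall d, ‖u‖ ≤ 1 := by
  filter_upwards [ae_cond_mem (μ := volume) (Metric.isClosed_closedBall.measurableSet :
    MeasurableSet (Metric.closedBall (0 : Euc d) 1))] with u hu
  simpa using hu

lemma integrable_norm_sq_unifBall : Integrable (fun u => ‖u‖ ^ 2) (unifBall d) := by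
  refine (integrable_const (1 : ℝ)).mono' (by fun_prop) ?_
  filter_upwards [ae_norm_le_one_unifBall] with u hu
  rw [norm_pow, norm_norm]
  exact pow_le_one₀ (norm_nonneg _) hu

lemma unifBall_le : unifBall d ≤
    ((volume : Measure (Euc d)) (Metric.closedBall 0 1))⁻¹ • volume := by
  rw [unifBall, ProbabilityTheory.cond]
  gcongr
  exact Measure.restrict_le_self

lemma measurable_mollify_map (ε : ℝ) : Measurable fun p : Euc d × Euc d => p.1 + ε • p.2 := by
  fun_prop

variable {μ : Measure (Euc d)}

lemma norm_add_smul_sq_le (ε : ℝ) (x u : Euc d) :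
    ‖x + ε • u‖ ^ 2 ≤ 2 * (‖x‖ ^ 2 + ε ^ 2 * ‖u‖ ^ 2) := by
  have h1 : ‖x + ε • u‖ ≤ ‖x‖ + |ε| * ‖u‖ := by
    simpa only [norm_smul, Real.norm_eq_abs] using norm_add_le x (ε • u)
  calc ‖x + ε • u‖ ^ 2 ≤ (‖x‖ + |ε| * ‖u‖) ^ 2 := by gcongr
    _ ≤ 2 * (‖x‖ ^ 2 + (|ε| * ‖u‖) ^ 2) := add_sq_le
    _ = _ := by rw [mul_pow, sq_abs]

lemma integrable_mollify_bound (hμ : IsP2 μ) (ε : ℝ) :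
    Integrable (fun p : Euc d × Euc d => 2 * (‖p.1‖ ^ 2 + ε ^ 2 * ‖p.2‖ ^ 2))
      (μ.prod (unifBall d)) := by
  have := hμ.1
  exact ((hμ.2.comp_fst _).add
    ((integrable_norm_sq_unifBall.const_mul (ε ^ 2)).comp_snd _)).const_mul 2

lemma isP2_mollify (hμ : IsP2 μ) (ε : ℝ) : IsP2 (mollify ε μ) := by
  have := hμ.1
  refine ⟨Measure.isProbabilityMeasure_map (measurable_mollify_map ε).aemeasurable, ?_⟩
  rw [mollify, integrable_map_measure (by fun_prop) (measurable_mollify_map ε).aemeasurable]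
  refine (integrable_mollify_bound hμ ε).mono' (by fun_prop) (ae_of_all _ fun p => ?_)
  simpa using norm_add_smul_sq_le ε p.1 p.2

lemma tendsto_integral_mollify (hμ : IsP2 μ) {ε : ℕ → ℝ} (hε : Tendsto ε atTop (nhds 0))
    {f : Euc d → ℝ} (hf : Continuous f) {bound : Euc d × Euc d → ℝ}
    (hbound : Integrable bound (μ.prod (unifBall d)))
    (hle : ∀ᶠ n in atTop, ∀ p : Euc d × Euc d, |f (p.1 + ε n • p.2)| ≤ bound p) :
    Tendsto (fun n => ∫ x, f x ∂mollify (ε n) μ) atTop (nhds (∫ x, f x ∂μ)) := by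
  have := hμ.1
  have h0 : ∫ x, f x ∂μ = ∫ p, f p.1 ∂(μ.prod (unifBall d)) := by
    rw [integral_fun_fst]; simp
  simp_rw [h0, mollify]
  have h1 : ∀ n, ∫ x, f x ∂((μ.prod (unifBall d)).map fun p => p.1 + ε n • p.2) =
      ∫ p, f (p.1 + ε n • p.2) ∂(μ.prod (unifBall d)) := fun n =>
    integral_map (measurable_mollify_map _).aemeasurable hf.aestronglyMeasurable
  simp_rw [h1]
  refine tendsto_integral_filter_of_dominated_convergence bound
    (Eventually.of_forall fun n => (hf.comp (by fun_prop)).aestronglyMeasurable)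
    (hle.mono fun n hn => ae_of_all _ hn) hbound (ae_of_all _ fun p => ?_)
  have h2 : Tendsto (fun n => p.1 + ε n • p.2) atTop (nhds (p.1 + (0 : ℝ) • p.2)) :=
    (hε.smul_const p.2).const_add p.1
  rw [zero_smul, add_zero] at h2
  exact (hf.tendsto _).comp h2

lemma eventually_abs_le_one {ε : ℕ → ℝ} (hε : Tendsto ε atTop (nhds 0)) :
    ∀ᶠ n in atTop, |ε n| ≤ 1 := by
  have h := hε.abs
  rw [abs_zero] at h
  exact h.eventually_le_const one_pos

lemma weakConv_mollify (hμ : IsP2 μ) {ε : ℕ → ℝ} (hε : Tendsto ε atTop (nhds 0)) :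
    WeakConv (fun n => mollify (ε n) μ) μ := fun f => by
  have := hμ.1
  exact tendsto_integral_mollify hμ hε f.continuous (integrable_const ‖f‖)
    (Eventually.of_forall fun n p => f.norm_coe_le_norm _)

lemma tendsto_secondMoment_mollify (hμ : IsP2 μ) {ε : ℕ → ℝ} (hε : Tendsto ε atTop (nhds 0)) :
    Tendsto (fun n => ∫ x, ‖x‖ ^ 2 ∂mollify (ε n) μ) atTop (nhds (∫ x, ‖x‖ ^ 2 ∂μ)) := by
  refine tendsto_integral_mollify hμ hε (by fun_prop) (integrable_mollify_bound hμ 1) ?_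
  filter_upwards [eventually_abs_le_one hε] with n hn p
  rw [abs_of_nonneg (by positivity)]
  refine (norm_add_smul_sq_le (ε n) p.1 p.2).trans ?_
  have := mul_le_mul_of_nonneg_right ((sq_le_one_iff_abs_le_one _).2 hn) (sq_nonneg ‖p.2‖)
  linarith

lemma mollify_le (hμ : IsP2 μ) {ε : ℝ} (hε : 0 < ε) :
    mollify ε μ ≤ ENNReal.ofReal
      (((volume : Measure (Euc d)).real (Metric.closedBall 0 1))⁻¹ * (ε ^ d)⁻¹) • volume := by
  have := hμ.1
  have hfin : (volume : Measure (Euc d)) (Metric.closedBall 0 1) ≠ ⊤ :=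
    (isCompact_closedBall _ _).measure_lt_top.ne
  refine Measure.le_iff.2 fun s hs => ?_
  rw [mollify, Measure.map_apply (measurable_mollify_map ε) hs,
    Measure.prod_apply (measurable_mollify_map ε hs)]
  have key : ∀ x : Euc d,
      unifBall d (Prod.mk x ⁻¹' ((fun p : Euc d × Euc d => p.1 + ε • p.2) ⁻¹' s)) ≤
        ENNReal.ofReal (((volume : Measure (Euc d)).real (Metric.closedBall 0 1))⁻¹ * (ε ^ d)⁻¹)
        * volume s := fun x => by
    have h1 : Prod.mk x ⁻¹' ((fun p : Euc d × Euc d => p.1 + ε • p.2) ⁻¹' s) =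
        (ε • ·) ⁻¹' ((x + ·) ⁻¹' s) := rfl
    refine (unifBall_le _).trans (le_of_eq ?_)
    rw [h1, Measure.smul_apply, Measure.addHaar_preimage_smul _ hε.ne', measure_preimage_add,
      smul_eq_mul, ← mul_assoc, ENNReal.ofReal_mul (by positivity), abs_of_pos (by positivity),
      measureReal_def,
      ENNReal.ofReal_inv_of_pos (ENNReal.toReal_pos volume_unitBall_ne_zero hfin),
      ENNReal.ofReal_toReal hfin, finrank_euclideanSpace_fin]
  calc _ ≤ ∫⁻ _, _ ∂μ := lintegral_mono key
    _ = _ := by simp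

lemma Ent_mollify_le (hμ : IsP2 μ) {ε : ℝ} (hε : 0 < ε) :
    Ent (mollify ε μ) ≤ ((-Real.log ((volume : Measure (Euc d)).real (Metric.closedBall 0 1)) -
      d * Real.log ε : ℝ) : EReal) := by
  have hV : 0 < (volume : Measure (Euc d)).real (Metric.closedBall 0 1) :=
    ENNReal.toReal_pos volume_unitBall_ne_zero (isCompact_closedBall _ _).measure_lt_top.ne
  refine (Ent_le_log (isP2_mollify hμ ε) (by positivity)
    (mollify_le hμ hε)).trans (le_of_eq ?_)
  rw [Real.log_mul (by positivity) (by positivity), Real.log_inv, Real.log_inv, Real.log_pow]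
  congr 1

/-- The entropy of a mollification of width `ε`, weighted by `ε`, is asymptotically nonpositive. -/
lemma tendsto_mul_mollify_Ent_bound {ε : ℕ → ℝ} (hε : Tendsto ε atTop (nhds 0)) (c k : ℝ) :
    Tendsto (fun n => ε n * (c - k * Real.log (ε n))) atTop (nhds 0) := by
  have h := (Real.continuous_mul_log.tendsto 0).comp hε
  have := (hε.mul_const c).sub (h.const_mul k)
  simp only [zero_mul, mul_zero, sub_zero] at this
  refine this.congr fun n => ?_
  simp only [Function.comp]
  ring

end Mollify

section Prediction

variable {k d : ℕ} {Ψ : Euc k → Euc d → ℝ} {R : ℝ}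

lemma measurable_prediction (hΨ : Measurable (Function.uncurry Ψ)) (μ : Measure (Euc d))
    [SFinite μ] : Measurable fun w => ∫ z, Ψ w z ∂μ :=
  (hΨ.stronglyMeasurable.integral_prod_right' (ν := μ)).measurable

lemma abs_prediction_le (hR : ∀ w z, |Ψ w z| ≤ R) (μ : Measure (Euc d)) [IsProbabilityMeasure μ]
    (w : Euc k) : |∫ z, Ψ w z ∂μ| ≤ R := by
  simpa using norm_integral_le_of_norm_le_const (f := Ψ w) (ae_of_all μ fun z => hR w z)

lemma WeakConv.tendsto_prediction {μseq : ℕ → Measure (Euc d)} {μ : Measure (Euc d)}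
    (h : WeakConv μseq μ) (hR : ∀ w z, |Ψ w z| ≤ R) {w : Euc k} (hc : Continuous (Ψ w)) :
    Tendsto (fun n => ∫ z, Ψ w z ∂μseq n) atTop (nhds (∫ z, Ψ w z ∂μ)) :=
  h (BoundedContinuousFunction.ofNormedAddCommGroup (Ψ w) hc R (hR w))

lemma WeakConv.eventually_lt_secondMoment {μseq : ℕ → Measure (Euc d)} {μ : Measure (Euc d)}
    (h : WeakConv μseq μ) (hμ : IsP2 μ) (hseq : ∀ n, IsP2 (μseq n)) {c : ℝ}
    (hc : c < ∫ x, ‖x‖ ^ 2 ∂μ) : ∀ᶠ n in atTop, c < ∫ x, ‖x‖ ^ 2 ∂μseq n := by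
  have := hμ.1
  have hlim : Tendsto (fun N : ℕ => ∫ x, min (‖x‖ ^ 2) (N : ℝ) ∂μ) atTop
      (nhds (∫ x, ‖x‖ ^ 2 ∂μ)) := by
    refine tendsto_integral_of_dominated_convergence (fun x => ‖x‖ ^ 2)
      (fun N => by fun_prop) hμ.2 (fun N => ae_of_all _ fun x => ?_) (ae_of_all _ fun x => ?_)
    · rw [Real.norm_of_nonneg (by positivity)]
      exact min_le_left _ _
    · refine tendsto_const_nhds.congr' ?_
      filter_upwards [eventually_ge_atTop ⌈‖x‖ ^ 2⌉₊] with N hN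
      exact (min_eq_left (Nat.ceil_le.1 hN)).symm
  obtain ⟨N, hN⟩ := (hlim.eventually_const_lt hc).exists
  have hb : ∀ x : Euc d, ‖min (‖x‖ ^ 2) (N : ℝ)‖ ≤ N := fun x => by
    rw [Real.norm_of_nonneg (by positivity)]
    exact min_le_right _ _
  have hconv := h (BoundedContinuousFunction.ofNormedAddCommGroup
    (fun x : Euc d => min (‖x‖ ^ 2) (N : ℝ)) (by fun_prop) N hb)
  filter_upwards [hconv.eventually_const_lt hN] with n hn
  have := (hseq n).1
  refine hn.trans_le (integral_mono ((integrable_const (N : ℝ)).mono' (by fun_prop)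
    (ae_of_all _ hb)) (hseq n).2 fun x => min_le_left _ _)

end Prediction

section SquareLoss

variable {α : Type*} [MeasurableSpace α] {ρ : Measure α} {R B : ℝ}

lemma integral_sq_midpoint_sub {u v w : α → ℝ} (huw : Integrable (fun p => (u p - w p) ^ 2) ρ)
    (hvw : Integrable (fun p => (v p - w p) ^ 2) ρ)
    (huv : Integrable (fun p => (u p - v p) ^ 2) ρ) :
    ∫ p, ((u p + v p) / 2 - w p) ^ 2 ∂ρ = 1 / 2 * (∫ p, (u p - w p) ^ 2 ∂ρ) +
      1 / 2 * (∫ p, (v p - w p) ^ 2 ∂ρ) - 1 / 4 * ∫ p, (u p - v p) ^ 2 ∂ρ := by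
  rw [← integral_const_mul, ← integral_const_mul, ← integral_const_mul,
    ← integral_add (huw.const_mul _) (hvw.const_mul _),
    ← integral_sub (f := fun p => 1 / 2 * (u p - w p) ^ 2 + 1 / 2 * (v p - w p) ^ 2)
      ((huw.const_mul _).add (hvw.const_mul _)) (huv.const_mul _)]
  congr 1
  ext p
  ring

variable [IsProbabilityMeasure ρ]

lemma integrable_of_abs_le {f : α → ℝ} (hf : Measurable f) (hle : ∀ᵐ p ∂ρ, |f p| ≤ R) :
    Integrable f ρ :=
  (integrable_const R).mono' hf.aestronglyMeasurable hle

lemma integrable_sq_of_abs_le {f : α → ℝ} (hf : Measurable f) (hle : ∀ᵐ p ∂ρ, |f p| ≤ R) :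
    Integrable (fun p => f p ^ 2) ρ := by
  refine integrable_of_abs_le (R := R ^ 2) (hf.pow_const 2) ?_
  filter_upwards [hle] with p hp
  rw [abs_pow]
  gcongr

lemma abs_half_integral_sq_sub_le {u v w : α → ℝ} (hu : Measurable u) (hv : Measurable v)
    (hw : Measurable w) (huR : ∀ p, |u p| ≤ R) (hvR : ∀ p, |v p| ≤ R)
    (hwB : ∀ᵐ p ∂ρ, |w p| ≤ B) :
    |1 / 2 * ∫ p, (u p - w p) ^ 2 ∂ρ - 1 / 2 * ∫ p, (v p - w p) ^ 2 ∂ρ| ≤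
      (R + B) * ∫ p, |u p - v p| ∂ρ := by
  have hint : ∀ f : α → ℝ, Measurable f → (∀ p, |f p| ≤ R) →
      Integrable (fun p => (f p - w p) ^ 2) ρ := fun f hf hfR => by
    refine integrable_sq_of_abs_le (R := R + B) (hf.sub hw) ?_
    filter_upwards [hwB] with p hp
    exact (abs_sub _ _).trans (add_le_add (hfR p) hp)
  have hduv : Integrable (fun p => |u p - v p|) ρ :=
    (integrable_of_abs_le (R := R + R) (hu.sub hv)
      (ae_of_all _ fun p => (abs_sub _ _).trans (add_le_add (huR p) (hvR p)))).abs
  rw [← mul_sub, ← integral_sub (hint u hu huR) (hint v hv hvR), ← integral_const_mul,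
    ← integral_const_mul]
  refine (abs_integral_le_integral_abs).trans (integral_mono_ae
    (((hint u hu huR).sub (hint v hv hvR)).const_mul _).abs (hduv.const_mul _) ?_)
  filter_upwards [hwB] with p hp
  have h1 : (1 : ℝ) / 2 * ((u p - w p) ^ 2 - (v p - w p) ^ 2) =
      ((u p + v p) / 2 - w p) * (u p - v p) := by ring
  simp only [h1, abs_mul]
  gcongr
  have h2 := abs_le.1 (huR p)
  have h3 := abs_le.1 (hvR p)
  have h4 := abs_le.1 hp
  rw [abs_le]
  constructor <;> linarith

lemma sq_integral_abs_le {f : α → ℝ} (hf : Measurable f) (hle : ∀ p, |f p| ≤ R) :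
    (∫ p, |f p| ∂ρ) ^ 2 ≤ ∫ p, f p ^ 2 ∂ρ := by
  have h1 : Integrable (fun p => |f p|) ρ := (integrable_of_abs_le hf (ae_of_all _ hle)).abs
  have h2 := integrable_sq_of_abs_le (ρ := ρ) hf (ae_of_all _ hle)
  set c := ∫ p, |f p| ∂ρ with hc
  have h3 : 0 ≤ ∫ p, (f p ^ 2 - 2 * c * |f p| + c ^ 2) ∂ρ := by
    refine integral_nonneg fun p => ?_
    have : f p ^ 2 - 2 * c * |f p| + c ^ 2 = (|f p| - c) ^ 2 := by
      rw [sub_sq, sq_abs]; ring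
    simp only [this]
    exact sq_nonneg _
  rw [integral_add (f := fun p => f p ^ 2 - 2 * c * |f p|) (h2.sub (h1.const_mul _))
      (integrable_const _),
    integral_sub h2 (h1.const_mul _), integral_const_mul, ← hc] at h3
  simp only [integral_const, probReal_univ, one_smul] at h3
  nlinarith

lemma tendsto_integral_abs_sub {f : ℕ → α → ℝ} {g : α → ℝ} (hf : ∀ n, Measurable (f n))
    (hg : Measurable g) (hfR : ∀ n p, |f n p| ≤ R) (hgR : ∀ p, |g p| ≤ R)
    (hlim : ∀ p, Tendsto (fun n => f n p) atTop (nhds (g p))) :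
    Tendsto (fun n => ∫ p, |f n p - g p| ∂ρ) atTop (nhds 0) := by
  have h := tendsto_integral_of_dominated_convergence (μ := ρ)
    (F := fun n p => |f n p - g p|) (f := fun _ => 0) (fun _ => R + R)
    (fun n => ((hf n).sub hg).abs.aestronglyMeasurable) (integrable_const _)
    (fun n => ae_of_all _ fun p => ?_) (ae_of_all _ fun p => ?_)
  · simpa using h
  · rw [Real.norm_eq_abs, abs_abs]
    exact (abs_sub _ _).trans (add_le_add (hfR n p) (hgR p))
  · have := ((hlim p).sub_const (g p)).abs
    rwa [sub_self, abs_zero] at this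

end SquareLoss

section StageOne

variable {da dw dx dz : ℕ} {ρ : Measure (Euc da × Euc dw × ℝ)}
  {ΨA : Euc da → Euc dx → ℝ} {ΨW : Euc dw → Euc dz → ℝ} {R M ζ1 : ℝ}

lemma secondMoment_le_F1 (hζ1 : 0 < ζ1) (μ : Measure (Euc dx)) (ν : Measure (Euc dz)) :
    ∫ z, ‖z‖ ^ 2 ∂ν ≤ 2 / ζ1 * F1 ρ ΨA ΨW ζ1 μ ν := by
  have h : 0 ≤ U1 ρ ΨA ΨW μ ν :=
    mul_nonneg (by norm_num) (integral_nonneg fun p => sq_nonneg _)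
  rw [F1, mul_add, ← mul_assoc, div_mul_div_cancel₀ hζ1.ne', div_self two_ne_zero, one_mul]
  have : 0 ≤ 2 / ζ1 * U1 ρ ΨA ΨW μ ν := by positivity
  linarith

variable [IsProbabilityMeasure ρ]

lemma A2.measurable_predA (hA2 : A2 ΨA ΨW R) (μ : Measure (Euc dx)) [SFinite μ] :
    Measurable fun p : Euc da × Euc dw × ℝ => ∫ x, ΨA p.1 x ∂μ :=
  (measurable_prediction hA2.1 μ).comp measurable_fst

lemma A2.measurable_predW (hA2 : A2 ΨA ΨW R) (ν : Measure (Euc dz)) [SFinite ν] :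
    Measurable fun p : Euc da × Euc dw × ℝ => ∫ z, ΨW p.2.1 z ∂ν :=
  (measurable_prediction hA2.2.1 ν).comp (measurable_fst.comp measurable_snd)

lemma A2.abs_predA_le (hA2 : A2 ΨA ΨW R) (μ : Measure (Euc dx)) [IsProbabilityMeasure μ]
    (a : Euc da) : |∫ x, ΨA a x ∂μ| ≤ R :=
  abs_prediction_le hA2.2.2.1 μ a

lemma A2.abs_predW_le (hA2 : A2 ΨA ΨW R) (ν : Measure (Euc dz)) [IsProbabilityMeasure ν]
    (w : Euc dw) : |∫ z, ΨW w z ∂ν| ≤ R :=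
  abs_prediction_le hA2.2.2.2.1 ν w

lemma abs_U1_sub_U1_le_left (hA2 : A2 ΨA ΨW R) (μ μ' : Measure (Euc dx)) (ν : Measure (Euc dz))
    [IsProbabilityMeasure μ] [IsProbabilityMeasure μ'] [IsProbabilityMeasure ν] :
    |U1 ρ ΨA ΨW μ ν - U1 ρ ΨA ΨW μ' ν| ≤
      (R + R) * ∫ p, |(∫ x, ΨA p.1 x ∂μ) - ∫ x, ΨA p.1 x ∂μ'| ∂ρ := by
  have h := abs_half_integral_sq_sub_le (ρ := ρ) (hA2.measurable_predA μ)
    (hA2.measurable_predA μ') (hA2.measurable_predW ν) (fun p => hA2.abs_predA_le μ p.1)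
    (fun p => hA2.abs_predA_le μ' p.1) (ae_of_all _ fun p => hA2.abs_predW_le ν p.2.1)
  have hcomm : ∀ κ : Measure (Euc dx), ∀ p : Euc da × Euc dw × ℝ,
      ((∫ x, ΨA p.1 x ∂κ) - ∫ z, ΨW p.2.1 z ∂ν) ^ 2 =
        ((∫ z, ΨW p.2.1 z ∂ν) - ∫ x, ΨA p.1 x ∂κ) ^ 2 := fun κ p => sub_sq_comm _ _
  simp only [hcomm] at h
  exact h

lemma abs_U1_sub_U1_le_right (hA2 : A2 ΨA ΨW R) (μ : Measure (Euc dx)) (ν ν' : Measure (Euc dz))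
    [IsProbabilityMeasure μ] [IsProbabilityMeasure ν] [IsProbabilityMeasure ν'] :
    |U1 ρ ΨA ΨW μ ν - U1 ρ ΨA ΨW μ ν'| ≤
      (R + R) * ∫ p, |(∫ z, ΨW p.2.1 z ∂ν) - ∫ z, ΨW p.2.1 z ∂ν'| ∂ρ :=
  abs_half_integral_sq_sub_le (ρ := ρ) (hA2.measurable_predW ν) (hA2.measurable_predW ν')
    (hA2.measurable_predA μ) (fun p => hA2.abs_predW_le ν p.2.1)
    (fun p => hA2.abs_predW_le ν' p.2.1) (ae_of_all _ fun p => hA2.abs_predA_le μ p.1)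

lemma abs_U2_sub_U2_le (hA1 : A1 ρ M) (hA2 : A2 ΨA ΨW R) (ν ν' : Measure (Euc dz))
    [IsProbabilityMeasure ν] [IsProbabilityMeasure ν'] :
    |U2 ρ ΨW ν - U2 ρ ΨW ν'| ≤
      (R + M) * ∫ p, |(∫ z, ΨW p.2.1 z ∂ν) - ∫ z, ΨW p.2.1 z ∂ν'| ∂ρ :=
  abs_half_integral_sq_sub_le (ρ := ρ) (hA2.measurable_predW ν) (hA2.measurable_predW ν')
    (measurable_snd.comp measurable_snd) (fun p => hA2.abs_predW_le ν p.2.1)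
    (fun p => hA2.abs_predW_le ν' p.2.1) hA1

lemma isP2_midpoint {ν ν' : Measure (Euc dz)} (hν : IsP2 ν) (hν' : IsP2 ν') :
    IsP2 ((2 : ℝ≥0∞)⁻¹ • (ν + ν')) := by
  have := hν.1
  have := hν'.1
  refine ⟨⟨?_⟩, (hν.2.add_measure hν'.2).smul_measure (by simp)⟩
  rw [Measure.smul_apply, Measure.add_apply, measure_univ, measure_univ, smul_eq_mul,
    one_add_one_eq_two, ENNReal.inv_mul_cancel two_ne_zero ENNReal.ofNat_ne_top]

lemma integral_midpoint {ν ν' : Measure (Euc dz)} {f : Euc dz → ℝ} (h : Integrable f ν)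
    (h' : Integrable f ν') :
    ∫ z, f z ∂((2 : ℝ≥0∞)⁻¹ • (ν + ν')) = (∫ z, f z ∂ν + ∫ z, f z ∂ν') / 2 := by
  rw [integral_smul_measure, integral_add_measure h h', ENNReal.toReal_inv, ENNReal.toReal_ofNat,
    smul_eq_mul]
  ring

/-- Strong convexity of `F₁(μ_x, ·)` in the prediction: the square distance between the predictions
of a minimizer and of a competitor is controlled by the excess value of the competitor. -/
lemma integral_sq_predW_sub_le (hA2 : A2 ΨA ΨW R) {μ : Measure (Euc dx)}
    [IsProbabilityMeasure μ] {ν ν₀ : Measure (Euc dz)} (hν : IsP2 ν) (hν₀ : IsP2 ν₀)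
    (hmin : ∀ ν', IsP2 ν' → F1 ρ ΨA ΨW ζ1 μ ν₀ ≤ F1 ρ ΨA ΨW ζ1 μ ν') :
    ∫ p, ((∫ z, ΨW p.2.1 z ∂ν) - ∫ z, ΨW p.2.1 z ∂ν₀) ^ 2 ∂ρ ≤
      4 * (F1 ρ ΨA ΨW ζ1 μ ν - F1 ρ ΨA ΨW ζ1 μ ν₀) := by
  have := hν.1
  have := hν₀.1
  have hΨ : ∀ (κ : Measure (Euc dz)) [IsProbabilityMeasure κ] (w : Euc dw),
      Integrable (ΨW w) κ := fun κ _ w =>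
    integrable_of_abs_le (hA2.2.1.comp measurable_prodMk_left) (ae_of_all _ (hA2.2.2.2.1 w))
  have hmid := hmin _ (isP2_midpoint hν hν₀)
  simp only [F1, U1, integral_midpoint hν.2 hν₀.2, integral_midpoint (hΨ ν _) (hΨ ν₀ _)] at hmid ⊢
  have hsq : ∀ u v : Euc da × Euc dw × ℝ → ℝ, Measurable u → Measurable v →
      (∀ p, |u p| ≤ R) → (∀ p, |v p| ≤ R) → Integrable (fun p => (u p - v p) ^ 2) ρ :=
    fun u v hu hv huR hvR => integrable_sq_of_abs_le (R := R + R) (hu.sub hv)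
      (ae_of_all _ fun p => (abs_sub _ _).trans (add_le_add (huR p) (hvR p)))
  have hmA := hA2.measurable_predA (dw := dw) μ
  have hmW := hA2.measurable_predW (da := da) ν
  have hmW₀ := hA2.measurable_predW (da := da) ν₀
  have hbA := fun p : Euc da × Euc dw × ℝ => hA2.abs_predA_le μ p.1
  have hbW := fun p : Euc da × Euc dw × ℝ => hA2.abs_predW_le ν p.2.1
  have hbW₀ := fun p : Euc da × Euc dw × ℝ => hA2.abs_predW_le ν₀ p.2.1
  have i1 := hsq _ _ hmW hmA hbW hbA
  have i2 := hsq _ _ hmW₀ hmA hbW₀ hbA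
  have i3 := hsq _ _ hmW hmW₀ hbW hbW₀
  rw [integral_sq_midpoint_sub i1 i2 i3] at hmid
  linarith

lemma tendsto_F1_mollify (hA2 : A2 ΨA ΨW R) (μ : Measure (Euc dx)) [IsProbabilityMeasure μ]
    {ν : Measure (Euc dz)} (hν : IsP2 ν) {ε : ℕ → ℝ} (hε : Tendsto ε atTop (nhds 0)) :
    Tendsto (fun n => F1 ρ ΨA ΨW ζ1 μ (mollify (ε n) ν)) atTop (nhds (F1 ρ ΨA ΨW ζ1 μ ν)) := by
  have := hν.1
  have hP : ∀ n, IsProbabilityMeasure (mollify (ε n) ν) := fun n => (isP2_mollify hν _).1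
  refine Tendsto.add ?_ ((tendsto_secondMoment_mollify hν hε).const_mul _)
  rw [tendsto_iff_norm_sub_tendsto_zero]
  refine squeeze_zero (fun n => norm_nonneg _)
    (fun n => abs_U1_sub_U1_le_right hA2 μ (mollify (ε n) ν) ν) ?_
  have h := tendsto_integral_abs_sub (ρ := ρ) (fun n => hA2.measurable_predW (mollify (ε n) ν))
    (hA2.measurable_predW ν) (fun n p => hA2.abs_predW_le _ p.2.1)
    (fun p => hA2.abs_predW_le _ p.2.1) fun p =>
      (weakConv_mollify hν hε).tendsto_prediction hA2.2.2.2.1 (hA2.2.2.2.2.2.2.1 p.2.1).continuous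
  simpa using h.const_mul (R + R)

/-- The Stage-II loss of the regularized Stage-I minimizers converges to that of the unregularized
one, along weakly convergent sequences and vanishing regularization. -/
lemma tendsto_U2_minimizer (hζ1 : 0 < ζ1) (hA1 : A1 ρ M) (hA2 : A2 ΨA ΨW R)
    {σ : ℕ → ℝ} (hσ : ∀ n, 0 < σ n) (hσ0 : Tendsto σ atTop (nhds 0))
    {μ : Measure (Euc dx)} (hμ : IsP2 μ) {μseq : ℕ → Measure (Euc dx)}
    (hseq : ∀ n, IsP2 (μseq n)) (hconv : WeakConv μseq μ)
    {ν₀ : Measure (Euc dz)} (hν₀ : IsP2 ν₀)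
    (hmin₀ : ∀ ν', IsP2 ν' → F1 ρ ΨA ΨW ζ1 μ ν₀ ≤ F1 ρ ΨA ΨW ζ1 μ ν')
    {ν : ℕ → Measure (Euc dz)} (hν : ∀ n, IsP2 (ν n))
    (hmin : ∀ n ν', IsP2 ν' →
      FEnt ρ ΨA ΨW ζ1 (σ n) (μseq n) (ν n) ≤ FEnt ρ ΨA ΨW ζ1 (σ n) (μseq n) ν') :
    Tendsto (fun n => U2 ρ ΨW (ν n)) atTop (nhds (U2 ρ ΨW ν₀)) := by
  have := hμ.1
  have := fun n => (hseq n).1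
  have := hν₀.1
  have := fun n => (hν n).1
  set E : Measure (Euc dz) → ℝ := F1 ρ ΨA ΨW ζ1 μ with hE
  set δ : ℕ → ℝ := fun n =>
    (R + R) * ∫ p, |(∫ x, ΨA p.1 x ∂μseq n) - ∫ x, ΨA p.1 x ∂μ| ∂ρ with hδ
  set C : ℝ := ∫ z : Euc dz, Real.exp (-‖z‖ ^ 2) with hC
  set c : ℝ := -Real.log ((volume : Measure (Euc dz)).real (Metric.closedBall 0 1)) with hc
  have hδ0 : Tendsto δ atTop (nhds 0) := by
    have h := tendsto_integral_abs_sub (ρ := ρ) (fun n => hA2.measurable_predA (μseq n))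
      (hA2.measurable_predA μ) (fun n p => hA2.abs_predA_le _ p.1)
      (fun p => hA2.abs_predA_le _ p.1) fun p =>
        hconv.tendsto_prediction hA2.2.2.1 (hA2.2.2.2.2.1 p.1).continuous
    simpa using h.const_mul (R + R)
  have hF1 : ∀ n (ν' : Measure (Euc dz)), IsP2 ν' →
      |F1 ρ ΨA ΨW ζ1 (μseq n) ν' - E ν'| ≤ δ n := fun n ν' hν' => by
    have := hν'.1
    simpa only [hE, F1, add_sub_add_right_eq_sub] using
      abs_U1_sub_U1_le_left hA2 (μseq n) μ ν'
  set b : ℕ → ℝ := fun n => (E (mollify (σ n) ν₀) + 2 * δ n +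
    σ n * (c - dz * Real.log (σ n)) + σ n * C) / (1 - σ n * (2 / ζ1)) with hb
  have hden : Tendsto (fun n => 1 - σ n * (2 / ζ1)) atTop (nhds 1) := by
    simpa using (hσ0.mul_const (2 / ζ1)).const_sub 1
  have hb0 : Tendsto b atTop (nhds (E ν₀)) := by
    have h := ((((tendsto_F1_mollify (ρ := ρ) (ζ1 := ζ1) hA2 μ hν₀ hσ0).add (hδ0.const_mul 2)).add
      (tendsto_mul_mollify_Ent_bound hσ0 c dz)).add (hσ0.mul_const C)).div hden one_ne_zero
    simp only [mul_zero, zero_mul, add_zero, div_one] at h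
    exact h
  have hEb : ∀ᶠ n in atTop, E (ν n) ≤ b n := by
    filter_upwards [hden.eventually_const_lt one_pos] with n hn
    have hP := isP2_mollify hν₀ (σ n)
    have hσn : (0 : EReal) ≤ (σ n : EReal) := EReal.coe_nonneg.2 (hσ n).le
    have h1 := (add_le_add_right (mul_le_mul_of_nonneg_left (le_Ent (hν n)) hσn)
      (F1 ρ ΨA ΨW ζ1 (μseq n) (ν n) : EReal)).trans ((hmin n _ hP).trans
      (add_le_add_right (mul_le_mul_of_nonneg_left (Ent_mollify_le hν₀ (hσ n)) hσn)
        (F1 ρ ΨA ΨW ζ1 (μseq n) (mollify (σ n) ν₀) : EReal)))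
    rw [← EReal.coe_mul, ← EReal.coe_mul, ← EReal.coe_add, ← EReal.coe_add,
      EReal.coe_le_coe_iff] at h1
    have h2 := abs_le.1 (hF1 n _ (hν n))
    have h3 := abs_le.1 (hF1 n _ hP)
    have h4 := mul_le_mul_of_nonneg_left
      (secondMoment_le_F1 (ρ := ρ) (ΨA := ΨA) (ΨW := ΨW) hζ1 μ (ν n)) (hσ n).le
    rw [hb, le_div_iff₀ hn]
    simp only [← hE, ← hC, ← hc] at h1 h4
    linarith
  have hEν : Tendsto (fun n => E (ν n)) atTop (nhds (E ν₀)) :=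
    tendsto_of_tendsto_of_tendsto_of_le_of_le' tendsto_const_nhds hb0
      (Eventually.of_forall fun n => hmin₀ _ (hν n)) hEb
  have hD : Tendsto (fun n => ∫ p, |(∫ z, ΨW p.2.1 z ∂ν n) - ∫ z, ΨW p.2.1 z ∂ν₀| ∂ρ) atTop
      (nhds 0) := by
    have hsqrt : Tendsto (fun n => √(4 * (E (ν n) - E ν₀))) atTop (nhds 0) := by
      simpa using ((hEν.sub_const (E ν₀)).const_mul 4).sqrt
    refine squeeze_zero (fun n => integral_nonneg fun p => abs_nonneg _) (fun n => ?_) hsqrt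
    refine Real.le_sqrt_of_sq_le (le_trans ?_ (integral_sq_predW_sub_le hA2 (hν n) hν₀ hmin₀))
    exact sq_integral_abs_le (R := R + R)
      ((hA2.measurable_predW (ν n)).sub (hA2.measurable_predW ν₀)) fun p =>
        (abs_sub _ _).trans (add_le_add (hA2.abs_predW_le _ _) (hA2.abs_predW_le _ _))
  rw [tendsto_iff_norm_sub_tendsto_zero]
  refine squeeze_zero (fun n => norm_nonneg _)
    (fun n => abs_U2_sub_U2_le hA1 hA2 (ν n) ν₀) ?_
  simpa using hD.const_mul (R + M)

end StageOne

/-- Proposition 4.4: Γ-convergence of `G_{σ̄₁,σ̄₂}` to `G_{0,0}` as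
`(σ̄₁, σ̄₂) → (0,0)`, with respect to weak convergence of probability measures. -/
theorem stmt9
    {da dw dx dz : ℕ} (hda : 0 < da) (hdw : 0 < dw) (hdx : 0 < dx) (hdz : 0 < dz)
    (R M ζ1 ζ2 : ℝ) (hR : 0 < R) (hM : 0 < M) (hζ1 : 0 < ζ1) (hζ2 : 0 < ζ2)
    (ρ : Measure (Euc da × Euc dw × ℝ)) (hρ : IsProbabilityMeasure ρ)
    (ΨA : Euc da → Euc dx → ℝ) (ΨW : Euc dw → Euc dz → ℝ)
    (hA1 : A1 ρ M) (hA2 : A2 ΨA ΨW R)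
    (s : ℝ → Measure (Euc dx) → Measure (Euc dz))
    (hs : ∀ s1 : ℝ, 0 ≤ s1 → ∀ μx, IsP2 μx →
      IsP2 (s s1 μx) ∧
      (∀ ν, IsP2 ν → FEnt ρ ΨA ΨW ζ1 s1 μx (s s1 μx) ≤ FEnt ρ ΨA ΨW ζ1 s1 μx ν) ∧
      (0 < s1 → FEnt ρ ΨA ΨW ζ1 s1 μx (s s1 μx) ≠ ⊤)) :
    ∀ σ1seq σ2seq : ℕ → ℝ, (∀ n, 0 < σ1seq n) → (∀ n, 0 < σ2seq n) →
      Tendsto σ1seq atTop (nhds 0) → Tendsto σ2seq atTop (nhds 0) →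
      (∀ μx : Measure (Euc dx), IsP2 μx → ∀ μseq : ℕ → Measure (Euc dx),
        (∀ n, IsP2 (μseq n)) → WeakConv μseq μx →
        Gfun ρ ΨA ΨW ζ1 ζ2 s 0 0 μx ≤
          Filter.liminf (fun n => Gfun ρ ΨA ΨW ζ1 ζ2 s (σ1seq n) (σ2seq n) (μseq n)) atTop) ∧
      (∀ μx : Measure (Euc dx), IsP2 μx → ∃ μseq : ℕ → Measure (Euc dx),
        (∀ n, IsP2 (μseq n)) ∧ WeakConv μseq μx ∧
        Filter.limsup (fun n => Gfun ρ ΨA ΨW ζ1 ζ2 s (σ1seq n) (σ2seq n) (μseq n)) atTop ≤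
          Gfun ρ ΨA ΨW ζ1 ζ2 s 0 0 μx) := by
  intro σ1 σ2 hσ1 hσ2 hσ1lim hσ2lim
  have hU2 : ∀ μx : Measure (Euc dx), IsP2 μx → ∀ μseq : ℕ → Measure (Euc dx),
      (∀ n, IsP2 (μseq n)) → WeakConv μseq μx →
      Tendsto (fun n => U2 ρ ΨW (s (σ1 n) (μseq n))) atTop (nhds (U2 ρ ΨW (s 0 μx))) := by
    intro μx hμx μseq hseq hconv
    have h0 := hs 0 le_rfl μx hμx
    refine tendsto_U2_minimizer hζ1 hA1 hA2 hσ1 hσ1lim hμx hseq hconv h0.1 (fun ν' hν' => ?_)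
      (fun n => (hs _ (hσ1 n).le _ (hseq n)).1) (fun n => (hs _ (hσ1 n).le _ (hseq n)).2.1)
    simpa [FEnt] using h0.2.1 ν' hν'
  have hG0 : ∀ μx : Measure (Euc dx), Gfun ρ ΨA ΨW ζ1 ζ2 s 0 0 μx =
      ((U2 ρ ΨW (s 0 μx) + (ζ2 / 2) * ∫ x, ‖x‖ ^ 2 ∂μx : ℝ) : EReal) := fun μx => by
    rw [Gfun, EReal.coe_zero, zero_mul, add_zero]
  refine ⟨fun μx hμx μseq hseq hconv => ?_, fun μx hμx => ?_⟩
  · rw [hG0]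
    set C : ℝ := ∫ x : Euc dx, Real.exp (-‖x‖ ^ 2)
    refine EReal.ge_of_forall_gt_iff_ge.1 fun t ht => ?_
    rw [EReal.coe_lt_coe_iff] at ht
    obtain ⟨m, hmt, hm⟩ : ∃ m, (t - U2 ρ ΨW (s 0 μx)) / (ζ2 / 2) < m ∧ m < ∫ x, ‖x‖ ^ 2 ∂μx := by
      refine exists_between ?_
      rw [div_lt_iff₀ (by positivity)]
      linarith
    rw [div_lt_iff₀ (by positivity)] at hmt
    have hlim : Tendsto (fun n => U2 ρ ΨW (s (σ1 n) (μseq n)) + (ζ2 / 2 - σ2 n) * m - σ2 n * C)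
        atTop (nhds (U2 ρ ΨW (s 0 μx) + (ζ2 / 2 - 0) * m - 0 * C)) :=
      ((hU2 μx hμx μseq hseq hconv).add ((hσ2lim.const_sub _).mul_const m)).sub
        (hσ2lim.mul_const C)
    refine le_liminf_of_le (by isBoundedDefault) ?_
    filter_upwards [hlim.eventually_const_lt (u := t) (by linarith),
      hconv.eventually_lt_secondMoment hμx hseq hm,
      hσ2lim.eventually_lt_const (u := ζ2 / 2) (by positivity)] with n h1 h2 h3
    refine le_trans ?_ (add_le_add_right
      (mul_le_mul_of_nonneg_left (le_Ent (hseq n)) (EReal.coe_nonneg.2 (hσ2 n).le)) _)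
    rw [← EReal.coe_mul, ← EReal.coe_add, EReal.coe_le_coe_iff]
    have := mul_le_mul_of_nonneg_left h2.le (sub_nonneg.2 h3.le)
    linarith
  · have hP : ∀ n, IsP2 (mollify (σ2 n) μx) := fun n => isP2_mollify hμx _
    have hconv := weakConv_mollify hμx hσ2lim
    refine ⟨fun n => mollify (σ2 n) μx, hP, hconv, ?_⟩
    set c : ℝ := -Real.log ((volume : Measure (Euc dx)).real (Metric.closedBall 0 1))
    have hlim := ((hU2 μx hμx _ hP hconv).add
      ((tendsto_secondMoment_mollify hμx hσ2lim).const_mul (ζ2 / 2))).add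
      (tendsto_mul_mollify_Ent_bound hσ2lim c dx)
    rw [add_zero] at hlim
    rw [hG0, ← ((continuous_coe_real_ereal.tendsto _).comp hlim).limsup_eq]
    refine limsup_le_limsup (Eventually.of_forall fun n => ?_)
    simp only [Function.comp, Gfun]
    rw [EReal.coe_add (_ + _), EReal.coe_mul (σ2 n)]
    exact add_le_add_right (mul_le_mul_of_nonneg_left (Ent_mollify_le hμx (hσ2 n))
      (EReal.coe_nonneg.2 (hσ2 n).le)) _
end
end

section
/- Assume (A1) and (A2), let λ > 0, and let μ_x, μ_x' ∈ P₂(ℝ^{d_x}). (i) If μ̃, μ̃' ∈ P₂(ℝ^{d_z}) minimize, with finite values, G_{μ_x} and G_{μ_x'} respectively over P₂(ℝ^{d_z}), then λσ₁·(KL(μ̃, μ̃') + KL(μ̃', μ̃)) ≤ (λ²/(4(1+λ)))·∫(∫Ψ_𝐚 dμ_x − ∫Ψ_𝐚 dμ_x')² dρ(𝐚,𝐰,y). (ii) If μ, μ' ∈ P₂(ℝ^{d_z}) minimize, with finite values, ν ↦ 𝓕₁(μ_x, ν) and ν ↦ 𝓕₁(μ_x', ν) respectively over P₂(ℝ^{d_z}),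 then σ₁·(KL(μ, μ') + KL(μ', μ)) ≤ (1/4)·∫(∫Ψ_𝐚 dμ_x − ∫Ψ_𝐚 dμ_x')² dρ(𝐚,𝐰,y). -/
open MeasureTheory ProbabilityTheory Real Filter
open scoped ENNReal Classical

noncomputable section

section Tilt

variable {da dw dx dz : ℕ}

/-- The λ-tilted Stage-I objective `G_{μ_x}(ν) = U₂(ν) + λF₁(μ_x, ν) + λσ₁ Ent(ν)`. -/
def Gtilt (ρ : Measure (Euc da × Euc dw × ℝ)) (ΨA : Euc da → Euc dx → ℝ)
    (ΨW : Euc dw → Euc dz → ℝ) (ζ1 σ1 lam : ℝ) (μx : Measure (Euc dx))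
    (ν : Measure (Euc dz)) : EReal :=
  ((U2 ρ ΨW ν + lam * F1 ρ ΨA ΨW ζ1 μx ν : ℝ) : EReal) + ((lam * σ1 : ℝ) : EReal) * Ent ν

/-- A λ-tilted Stage-I selection: to each `μ_x ∈ P₂` it assigns a global minimizer of
`G_{μ_x}` over `P₂(ℝ^{d_z})`, with finite value. -/
def IsTiltedSel (ρ : Measure (Euc da × Euc dw × ℝ)) (ΨA : Euc da → Euc dx → ℝ)
    (ΨW : Euc dw → Euc dz → ℝ) (ζ1 σ1 lam : ℝ)
    (til : Measure (Euc dx) → Measure (Euc dz)) : Prop :=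
  ∀ μx, IsP2 μx →
    IsP2 (til μx) ∧ Gtilt ρ ΨA ΨW ζ1 σ1 lam μx (til μx) ≠ ⊤ ∧
      Gtilt ρ ΨA ΨW ζ1 σ1 lam μx (til μx) ≠ ⊥ ∧
      ∀ ν, IsP2 ν → Gtilt ρ ΨA ΨW ζ1 σ1 lam μx (til μx) ≤ Gtilt ρ ΨA ΨW ζ1 σ1 lam μx ν

end Tilt

open Topology

/-- The Bregman divergence of `x ↦ x log x` on `[0, ∞)`. -/
def entBregman (x y : ℝ) : ℝ := x * log x - x * log y - x + y

lemma mul_log_le_mul_log_self {x y : ℝ} (hx : 0 ≤ x) (hy : 0 ≤ y) (hxy : y = 0 → x = 0) :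
    x * log y ≤ x * log x - x + y := by
  rcases hx.eq_or_lt with rfl | hx
  · simpa using hy
  have hy' : 0 < y := hy.lt_of_ne fun h => hx.ne' (hxy h.symm)
  have h1 := log_le_sub_one_of_pos (div_pos hy' hx)
  rw [log_div hy'.ne' hx.ne'] at h1
  have h2 := mul_le_mul_of_nonneg_left h1 hx.le
  have h3 : x * (y / x - 1) = y - x := by field_simp
  linarith

lemma entBregman_nonneg {x y : ℝ} (hx : 0 ≤ x) (hy : 0 ≤ y) (hxy : y = 0 → x = 0) :
    0 ≤ entBregman x y := by
  have := mul_log_le_mul_log_self hx hy hxy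
  unfold entBregman
  linarith

lemma eq_zero_of_mix_eq_zero {x y t : ℝ} (hx : 0 ≤ x) (hy : 0 ≤ y) (ht : 0 < t) (ht' : t < 1)
    (h : (1 - t) * x + t * y = 0) : x = 0 ∧ y = 0 := by
  have hx' := mul_nonneg (sub_pos.2 ht').le hx
  have hy' := mul_nonneg ht.le hy
  have h1 : (1 - t) * x = 0 := by linarith
  have h2 : t * y = 0 := by linarith
  exact ⟨(mul_eq_zero.1 h1).resolve_left (sub_pos.2 ht').ne',
    (mul_eq_zero.1 h2).resolve_left ht.ne'⟩

lemma mix_mul_log_add_entBregman_le {x y t : ℝ} (hx : 0 ≤ x) (hy : 0 ≤ y) (ht : 0 < t)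
    (ht' : t < 1) :
    ((1 - t) * x + t * y) * log ((1 - t) * x + t * y)
        + t * entBregman y ((1 - t) * x + t * y)
      ≤ (1 - t) * (x * log x) + t * (y * log y) := by
  have hm : 0 ≤ (1 - t) * x + t * y :=
    add_nonneg (mul_nonneg (sub_pos.2 ht').le hx) (mul_nonneg ht.le hy)
  have h := mul_le_mul_of_nonneg_left
    (mul_log_le_mul_log_self hx hm fun h => (eq_zero_of_mix_eq_zero hx hy ht ht' h).1)
    (sub_pos.2 ht').le
  unfold entBregman
  nlinarith [h]

lemma entBregman_mix_nonneg {x y t : ℝ} (hx : 0 ≤ x) (hy : 0 ≤ y) (ht : 0 < t) (ht' : t < 1) :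
    0 ≤ entBregman y ((1 - t) * x + t * y) :=
  entBregman_nonneg hy (add_nonneg (mul_nonneg (sub_pos.2 ht').le hx) (mul_nonneg ht.le hy))
    fun h => (eq_zero_of_mix_eq_zero hx hy ht ht' h).2

lemma mul_log_le_of_smul_le {x m s : ℝ} (hx : 0 ≤ x) (hs : 0 < s) (h : s * x ≤ m) :
    s * (x * log x) + s * log s * x ≤ s * x * log m := by
  rcases hx.eq_or_lt with rfl | hx
  · simp
  have h1 := log_le_log (mul_pos hs hx) h
  rw [log_mul hs.ne' hx.ne'] at h1
  have := mul_le_mul_of_nonneg_left h1 (mul_pos hs hx).le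
  linarith

section Density

variable {α : Type*} [MeasurableSpace α] {ν : Measure α} {f g : α → ℝ}

lemma integrable_mix_mul_log (hf : Measurable f) (hg : Measurable g)
    (hf0 : ∀ x, 0 ≤ f x) (hg0 : ∀ x, 0 ≤ g x) (hfi : Integrable f ν) (hgi : Integrable g ν)
    (hfl : Integrable (fun x => f x * log (f x)) ν)
    (hgl : Integrable (fun x => g x * log (g x)) ν) {t : ℝ} (ht : 0 < t) (ht' : t < 1) :
    Integrable (fun x => ((1 - t) * f x + t * g x) * log ((1 - t) * f x + t * g x)) ν := by
  have hs : 0 < 1 - t := sub_pos.2 ht'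
  refine integrable_of_le_of_le
    (g₁ := fun x => ((1 - t) * (f x * log (f x)) + (1 - t) * log (1 - t) * f x)
      + (t * (g x * log (g x)) + t * log t * g x))
    (g₂ := fun x => (1 - t) * (f x * log (f x)) + t * (g x * log (g x))) ?_ ?_ ?_ ?_ ?_
  · exact Measurable.aestronglyMeasurable (by fun_prop)
  · refine Eventually.of_forall fun x => ?_
    have h1 := mul_nonneg hs.le (hf0 x)
    have h2 := mul_nonneg ht.le (hg0 x)
    have h3 := mul_log_le_of_smul_le (m := (1 - t) * f x + t * g x) (hf0 x) hs (by linarith)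
    have h4 := mul_log_le_of_smul_le (m := (1 - t) * f x + t * g x) (hg0 x) ht (by linarith)
    simp only [add_mul _ _ (log _)]
    linarith
  · refine Eventually.of_forall fun x => ?_
    have h1 := mix_mul_log_add_entBregman_le (hf0 x) (hg0 x) ht ht'
    have h2 := mul_nonneg ht.le (entBregman_mix_nonneg (hf0 x) (hg0 x) ht ht')
    dsimp only
    linarith
  · exact ((hfl.const_mul _).add (hfi.const_mul _)).add ((hgl.const_mul _).add (hgi.const_mul _))
  · exact (hfl.const_mul _).add (hgl.const_mul _)

lemma integral_entBregman_mix_le (hf : Measurable f) (hg : Measurable g)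
    (hf0 : ∀ x, 0 ≤ f x) (hg0 : ∀ x, 0 ≤ g x) (hfi : Integrable f ν) (hgi : Integrable g ν)
    (hfl : Integrable (fun x => f x * log (f x)) ν)
    (hgl : Integrable (fun x => g x * log (g x)) ν) {t : ℝ} (ht : 0 < t) (ht' : t < 1) {c : ℝ}
    (hc : 0 ≤ t * c + ∫ x, ((1 - t) * f x + t * g x) * log ((1 - t) * f x + t * g x) ∂ν
      - ∫ x, f x * log (f x) ∂ν) :
    Integrable (fun x => entBregman (g x) ((1 - t) * f x + t * g x)) ν ∧
      ∫ x, entBregman (g x) ((1 - t) * f x + t * g x) ∂ν ≤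
        c + ∫ x, g x * log (g x) ∂ν - ∫ x, f x * log (f x) ∂ν := by
  have hm := integrable_mix_mul_log hf hg hf0 hg0 hfi hgi hfl hgl ht ht'
  set K : α → ℝ := fun x => t⁻¹ * ((1 - t) * (f x * log (f x)) + t * (g x * log (g x))
    - ((1 - t) * f x + t * g x) * log ((1 - t) * f x + t * g x)) with hK
  have hKi : Integrable K ν := (((hfl.const_mul _).add (hgl.const_mul _)).sub hm).const_mul _
  have hle : ∀ x, entBregman (g x) ((1 - t) * f x + t * g x) ≤ K x := fun x => by
    have h1 := mix_mul_log_add_entBregman_le (hf0 x) (hg0 x) ht ht'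
    simp only [hK]
    rw [inv_mul_eq_div, le_div_iff₀ ht]
    linarith
  have hi : Integrable (fun x => entBregman (g x) ((1 - t) * f x + t * g x)) ν := by
    refine integrable_of_le_of_le (g₁ := fun _ => 0) (g₂ := K) ?_
      (Eventually.of_forall fun x => entBregman_mix_nonneg (hf0 x) (hg0 x) ht ht')
      (Eventually.of_forall hle) (integrable_zero _ _ _) hKi
    unfold entBregman
    exact Measurable.aestronglyMeasurable (by fun_prop)
  refine ⟨hi, (integral_mono hi hKi hle).trans ?_⟩
  rw [hK, integral_const_mul, integral_sub _ hm, integral_add, integral_const_mul,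
    integral_const_mul, inv_mul_eq_div, div_le_iff₀ ht]
  · linarith
  · exact hfl.const_mul _
  · exact hgl.const_mul _
  · exact (hfl.const_mul _).add (hgl.const_mul _)

lemma tendsto_mix_zero (x y : ℝ) :
    Tendsto (fun t : ℝ => (1 - t) * x + t * y) (𝓝[>] 0) (𝓝 x) := by
  have h : Continuous fun t : ℝ => (1 - t) * x + t * y := by fun_prop
  simpa using (h.tendsto 0).mono_left nhdsWithin_le_nhds

lemma tendsto_entBregman_mix {x y : ℝ} (hxy : x = 0 → y = 0) :
    Tendsto (fun t : ℝ => entBregman y ((1 - t) * x + t * y)) (𝓝[>] 0) (𝓝 (entBregman y x)) := by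
  unfold entBregman
  by_cases hx : x = 0
  · simp [hx, hxy hx]
  · have h := tendsto_mix_zero x y
    exact (tendsto_const_nhds.sub (tendsto_const_nhds.mul (h.log hx))).sub_const _ |>.add h

lemma tendsto_entBregman_mul_self {y : ℝ} (hy : 0 < y) :
    Tendsto (fun t : ℝ => entBregman y ((1 - t) * 0 + t * y)) (𝓝[>] 0) atTop := by
  have h : Tendsto (fun t : ℝ => -y + t * y + y * -log t) (𝓝[>] 0) atTop := by
    refine Tendsto.add_atTop (C := -y + 0 * y) ?_ ?_
    · have h : Continuous fun t : ℝ => -y + t * y := by fun_prop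
      exact (h.tendsto 0).mono_left nhdsWithin_le_nhds
    · exact (tendsto_neg_atBot_atTop.comp tendsto_log_nhdsGT_zero).const_mul_atTop hy
  refine h.congr' ?_
  filter_upwards [self_mem_nhdsWithin] with t ht
  rw [entBregman, mul_zero, zero_add, log_mul (ne_of_gt ht) hy.ne']
  ring

/-- If `t ↦ a t + b t² + ∫ hₜ log hₜ` is minimal at `t = 0` along the segment
`hₜ = (1 - t) f + t g`, then `g` has finite Bregman
divergence from `f`, with the bound given by the formal first-order condition. -/
lemma entBregman_le_of_segment_minimal (hf : Measurable f) (hg : Measurable g)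
    (hf0 : ∀ x, 0 ≤ f x) (hg0 : ∀ x, 0 ≤ g x) (hfi : Integrable f ν) (hgi : Integrable g ν)
    (hfl : Integrable (fun x => f x * log (f x)) ν)
    (hgl : Integrable (fun x => g x * log (g x)) ν) {a b : ℝ}
    (H : ∀ t : ℝ, 0 < t → t < 1 → 0 ≤ t * (a + t * b) +
      ∫ x, ((1 - t) * f x + t * g x) * log ((1 - t) * f x + t * g x) ∂ν
      - ∫ x, f x * log (f x) ∂ν) :
    (∀ᵐ x ∂ν, f x = 0 → g x = 0) ∧ Integrable (fun x => entBregman (g x) (f x)) ν ∧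
      ∫ x, entBregman (g x) (f x) ∂ν ≤
        a + ∫ x, g x * log (g x) ∂ν - ∫ x, f x * log (f x) ∂ν := by
  set E := ∫ x, g x * log (g x) ∂ν
  set E' := ∫ x, f x * log (f x) ∂ν
  set D : ℝ → α → ENNReal :=
    fun t x => ENNReal.ofReal (entBregman (g x) ((1 - t) * f x + t * g x)) with hD
  obtain ⟨u, hu⟩ := exists_seq_tendsto (𝓝[>] (0 : ℝ))
  have hunit : ∀ᶠ n in atTop, u n ∈ Set.Ioo (0 : ℝ) 1 :=
    hu.eventually (Ioo_mem_nhdsGT one_pos)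
  have hlim : Tendsto (fun n => (a + u n * b) + E - E') atTop (𝓝 (a + E - E')) := by
    have h : Continuous fun t : ℝ => (a + t * b) + E - E' := by fun_prop
    have h0 := ((h.tendsto 0).mono_left nhdsWithin_le_nhds).comp hu
    simpa [Function.comp_def] using h0
  have hDm : ∀ t, Measurable (D t) := fun t => by
    simp only [hD, entBregman]
    fun_prop
  have hfatou : ∫⁻ x, liminf (fun n => D (u n) x) atTop ∂ν ≤ ENNReal.ofReal (a + E - E') := by
    refine (lintegral_liminf_le fun n => hDm (u n)).trans ?_
    rw [← (ENNReal.tendsto_ofReal hlim).liminf_eq]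
    refine liminf_le_liminf ?_
    filter_upwards [hunit] with n ht
    obtain ⟨hi, hb⟩ :=
      integral_entBregman_mix_le hf hg hf0 hg0 hfi hgi hfl hgl ht.1 ht.2 (H _ ht.1 ht.2)
    rw [hD, ← ofReal_integral_eq_lintegral_ofReal hi (Eventually.of_forall fun x =>
      entBregman_mix_nonneg (hf0 x) (hg0 x) ht.1 ht.2)]
    exact ENNReal.ofReal_le_ofReal hb
  have hmeas : Measurable fun x => liminf (fun n => D (u n) x) atTop := by
    exact Measurable.liminf fun n => hDm (u n)
  have hac : ∀ᵐ x ∂ν, f x = 0 → g x = 0 := by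
    filter_upwards [ae_lt_top hmeas (hfatou.trans_lt ENNReal.ofReal_lt_top).ne] with x hx hfx
    by_contra hgx
    have h := ENNReal.tendsto_ofReal_atTop.comp
      (tendsto_entBregman_mul_self ((hg0 x).lt_of_ne' hgx))
    have : liminf (fun n => D (u n) x) atTop = ⊤ := by
      simp only [hD, hfx]
      exact (h.comp hu).liminf_eq
    exact hx.ne this
  have hBm : Measurable fun x => entBregman (g x) (f x) := by
    simp only [entBregman]
    fun_prop
  have hB0 : 0 ≤ᵐ[ν] fun x => entBregman (g x) (f x) := by
    filter_upwards [hac] with x hx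
    exact entBregman_nonneg (hg0 x) (hf0 x) hx
  have hle : ∫⁻ x, ENNReal.ofReal (entBregman (g x) (f x)) ∂ν ≤ ENNReal.ofReal (a + E - E') := by
    refine le_trans (lintegral_mono_ae ?_) hfatou
    filter_upwards [hac] with x hx
    exact ((ENNReal.tendsto_ofReal (tendsto_entBregman_mix hx)).comp hu).liminf_eq.ge
  have hBi : Integrable (fun x => entBregman (g x) (f x)) ν :=
    (lintegral_ofReal_ne_top_iff_integrable hBm.aestronglyMeasurable hB0).1
      (hle.trans_lt ENNReal.ofReal_lt_top).ne
  have hpos : 0 ≤ a + E - E' := by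
    refine ge_of_tendsto hlim ?_
    filter_upwards [hunit] with n ht
    exact (integral_nonneg fun x => entBregman_mix_nonneg (hf0 x) (hg0 x) ht.1 ht.2).trans
      (integral_entBregman_mix_le hf hg hf0 hg0 hfi hgi hfl hgl ht.1 ht.2 (H _ ht.1 ht.2)).2
  refine ⟨hac, hBi, ?_⟩
  rw [← ofReal_integral_eq_lintegral_ofReal hBi hB0] at hle
  exact (ENNReal.ofReal_le_ofReal_iff hpos).1 hle

end Density

section Segment

variable {d : ℕ}

lemma exists_ent_density {μ : Measure (Euc d)} [IsFiniteMeasure μ] (h : Ent μ ≠ ⊤) :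
    μ ≪ volume ∧
      Integrable (fun x => (μ.rnDeriv volume x).toReal * log (μ.rnDeriv volume x).toReal) ∧
      Ent μ = ((∫ x, (μ.rnDeriv volume x).toReal * log (μ.rnDeriv volume x).toReal : ℝ) :
        EReal) := by
  unfold Ent at h ⊢
  split_ifs at h ⊢ with hc
  · refine ⟨hc.1, (integrable_rnDeriv_smul_iff hc.1).2 hc.2, ?_⟩
    rw [← integral_rnDeriv_smul hc.1]
    rfl
  · exact absurd rfl h

lemma Ent_eq_of_rnDeriv_ae_eq {μ : Measure (Euc d)} [IsFiniteMeasure μ] (hμ : μ ≪ volume)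
    {h : Euc d → ℝ} (hh : (fun x => (μ.rnDeriv volume x).toReal) =ᵐ[volume] h)
    (hi : Integrable fun x => h x * log (h x)) :
    Ent μ = ((∫ x, h x * log (h x) : ℝ) : EReal) := by
  have hae : (fun x => (μ.rnDeriv volume x).toReal • log (μ.rnDeriv volume x).toReal)
      =ᵐ[volume] fun x => h x * log (h x) := by
    filter_upwards [hh] with x hx
    rw [hx, smul_eq_mul]
  rw [Ent, if_pos ⟨hμ, (integrable_rnDeriv_smul_iff hμ).1 (hi.congr hae.symm)⟩,
    ← integral_rnDeriv_smul hμ, integral_congr_ae hae]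

lemma KL_eq_integral_entBregman {α : Type*} [MeasurableSpace α] {ν μ μ' : Measure α}
    [SigmaFinite ν] [IsProbabilityMeasure μ] [IsProbabilityMeasure μ']
    (hμ : μ ≪ ν) (hμ' : μ' ≪ ν)
    (h0 : ∀ᵐ x ∂ν, (μ.rnDeriv ν x).toReal = 0 → (μ'.rnDeriv ν x).toReal = 0)
    (hi : Integrable
      (fun x => entBregman (μ'.rnDeriv ν x).toReal (μ.rnDeriv ν x).toReal) ν) :
    KL μ' μ =
      ((∫ x, entBregman (μ'.rnDeriv ν x).toReal (μ.rnDeriv ν x).toReal ∂ν : ℝ) : EReal) := by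
  have hac : μ' ≪ μ := by
    refine Measure.AbsolutelyContinuous.mk fun s hs hμs => ?_
    rw [← Measure.withDensity_rnDeriv_eq μ ν hμ, withDensity_apply _ hs,
      lintegral_eq_zero_iff (Measure.measurable_rnDeriv _ _)] at hμs
    rw [← Measure.withDensity_rnDeriv_eq μ' ν hμ', withDensity_apply _ hs,
      lintegral_eq_zero_iff (Measure.measurable_rnDeriv _ _)]
    filter_upwards [hμs, ae_restrict_of_ae h0,
      ae_restrict_of_ae (Measure.rnDeriv_lt_top μ' ν)] with x hx hx0 hxt
    have h1 := hx0 (by rw [hx]; rfl)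
    exact (ENNReal.toReal_eq_zero_iff _).1 h1 |>.resolve_right hxt.ne
  have hae : (fun x => (μ'.rnDeriv ν x).toReal • log (μ'.rnDeriv μ x).toReal) =ᵐ[ν]
      fun x => entBregman (μ'.rnDeriv ν x).toReal (μ.rnDeriv ν x).toReal
        + (μ'.rnDeriv ν x).toReal - (μ.rnDeriv ν x).toReal := by
    filter_upwards [Measure.rnDeriv_mul_rnDeriv (κ := ν) hac] with x hx
    have hx' : (μ'.rnDeriv ν x).toReal = (μ'.rnDeriv μ x).toReal * (μ.rnDeriv ν x).toReal := by
      rw [← hx, Pi.mul_apply, ENNReal.toReal_mul]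
    by_cases hz : (μ'.rnDeriv ν x).toReal = 0
    · simp [entBregman, hz]
    · have hz' := hz
      rw [hx'] at hz'
      have h1 : log (μ'.rnDeriv ν x).toReal
          = log (μ'.rnDeriv μ x).toReal + log (μ.rnDeriv ν x).toReal := by
        rw [hx', log_mul (left_ne_zero_of_mul hz') (right_ne_zero_of_mul hz')]
      rw [entBregman, h1, smul_eq_mul]
      ring
  have hd : Integrable (fun x => (μ.rnDeriv ν x).toReal) ν := Measure.integrable_toReal_rnDeriv
  have hd' : Integrable (fun x => (μ'.rnDeriv ν x).toReal) ν := Measure.integrable_toReal_rnDeriv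
  have hs : Integrable (fun x => entBregman (μ'.rnDeriv ν x).toReal (μ.rnDeriv ν x).toReal
      + (μ'.rnDeriv ν x).toReal) ν := hi.add hd'
  rw [KL, if_pos ⟨hac, (integrable_rnDeriv_smul_iff hμ').1
    ((hs.sub hd).congr hae.symm)⟩, ← integral_rnDeriv_smul hμ', integral_congr_ae hae,
    integral_sub hs hd, integral_add hi hd', Measure.integral_toReal_rnDeriv hμ,
    Measure.integral_toReal_rnDeriv hμ']
  simp

/-- The point at parameter `t` on the segment from `μ` to `μ'`. -/
def mixture {α : Type*} [MeasurableSpace α] (t : ℝ) (μ μ' : Measure α) : Measure α :=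
  ENNReal.ofReal (1 - t) • μ + ENNReal.ofReal t • μ'

lemma isProbabilityMeasure_mixture {α : Type*} [MeasurableSpace α] {μ μ' : Measure α}
    [IsProbabilityMeasure μ] [IsProbabilityMeasure μ'] {t : ℝ} (ht : 0 ≤ t) (ht' : t ≤ 1) :
    IsProbabilityMeasure (mixture t μ μ') := by
  constructor
  simp [mixture, ← ENNReal.ofReal_add (sub_nonneg.2 ht') ht]

lemma integrable_mixture {α : Type*} [MeasurableSpace α] {μ μ' : Measure α} {h : α → ℝ}
    (hi : Integrable h μ) (hi' : Integrable h μ') (t : ℝ) : Integrable h (mixture t μ μ') :=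
  (hi.smul_measure ENNReal.ofReal_ne_top).add_measure (hi'.smul_measure ENNReal.ofReal_ne_top)

lemma integral_mixture {α : Type*} [MeasurableSpace α] {μ μ' : Measure α} {h : α → ℝ}
    (hi : Integrable h μ) (hi' : Integrable h μ') {t : ℝ} (ht : 0 ≤ t) (ht' : t ≤ 1) :
    ∫ x, h x ∂(mixture t μ μ') = (1 - t) * ∫ x, h x ∂μ + t * ∫ x, h x ∂μ' := by
  rw [mixture, integral_add_measure (hi.smul_measure ENNReal.ofReal_ne_top)
    (hi'.smul_measure ENNReal.ofReal_ne_top), integral_smul_measure, integral_smul_measure,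
    ENNReal.toReal_ofReal (sub_nonneg.2 ht'), ENNReal.toReal_ofReal ht, smul_eq_mul, smul_eq_mul]

lemma IsP2.mixture {μ μ' : Measure (Euc d)} (hμ : IsP2 μ) (hμ' : IsP2 μ') {t : ℝ} (ht : 0 ≤ t)
    (ht' : t ≤ 1) : IsP2 (mixture t μ μ') := by
  have := hμ.1
  have := hμ'.1
  exact ⟨isProbabilityMeasure_mixture ht ht', integrable_mixture hμ.2 hμ'.2 t⟩

lemma toReal_rnDeriv_mixture {α : Type*} [MeasurableSpace α] {ν μ μ' : Measure α} [SigmaFinite ν]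
    [IsFiniteMeasure μ] [IsFiniteMeasure μ'] {t : ℝ} (ht : 0 ≤ t) (ht' : t ≤ 1) :
    (fun x => ((mixture t μ μ').rnDeriv ν x).toReal) =ᵐ[ν]
      fun x => (1 - t) * (μ.rnDeriv ν x).toReal + t * (μ'.rnDeriv ν x).toReal := by
  have := μ.smul_finite (c := ENNReal.ofReal (1 - t)) ENNReal.ofReal_ne_top
  have := μ'.smul_finite (c := ENNReal.ofReal t) ENNReal.ofReal_ne_top
  filter_upwards [Measure.rnDeriv_add (ENNReal.ofReal (1 - t) • μ) (ENNReal.ofReal t • μ') ν,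
    Measure.rnDeriv_smul_left_of_ne_top μ ν (r := ENNReal.ofReal (1 - t)) ENNReal.ofReal_ne_top,
    Measure.rnDeriv_smul_left_of_ne_top μ' ν (r := ENNReal.ofReal t) ENNReal.ofReal_ne_top,
    Measure.rnDeriv_lt_top μ ν, Measure.rnDeriv_lt_top μ' ν] with x h1 h2 h3 h4 h5
  rw [mixture, h1, Pi.add_apply, h2, h3, Pi.smul_apply, Pi.smul_apply, smul_eq_mul, smul_eq_mul,
    ENNReal.toReal_add (ENNReal.mul_ne_top ENNReal.ofReal_ne_top h4.ne)
      (ENNReal.mul_ne_top ENNReal.ofReal_ne_top h5.ne), ENNReal.toReal_mul, ENNReal.toReal_mul,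
    ENNReal.toReal_ofReal (sub_nonneg.2 ht'), ENNReal.toReal_ofReal ht]

/-- First-order optimality for an entropy-regularized objective `Q + c Ent` that is quadratic
along the segment from `μ` to `μ'`. -/
lemma KL_le_of_minimal_on_segment {μ μ' : Measure (Euc d)} [IsProbabilityMeasure μ]
    [IsProbabilityMeasure μ'] (hμ : Ent μ ≠ ⊤) (hμ' : Ent μ' ≠ ⊤) {c : ℝ} (hc : 0 < c)
    {Q : Measure (Euc d) → ℝ} {a b : ℝ}
    (hQ : ∀ t, 0 < t → t < 1 → Q (mixture t μ μ') = Q μ + t * (a + t * b))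
    (hmin : ∀ t, 0 < t → t < 1 → (Q μ : EReal) + c * Ent μ ≤
      Q (mixture t μ μ') + c * Ent (mixture t μ μ')) :
    ∃ k : ℝ, KL μ' μ = k ∧ c * k ≤ a + c * (Ent μ').toReal - c * (Ent μ).toReal := by
  obtain ⟨hac, hfl, hE⟩ := exists_ent_density hμ
  obtain ⟨hac', hgl, hE'⟩ := exists_ent_density hμ'
  have hf : Measurable fun x => (μ.rnDeriv volume x).toReal :=
    (Measure.measurable_rnDeriv _ _).ennreal_toReal
  have hg : Measurable fun x => (μ'.rnDeriv volume x).toReal :=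
    (Measure.measurable_rnDeriv _ _).ennreal_toReal
  have hfi : Integrable (fun x => (μ.rnDeriv volume x).toReal) volume :=
    Measure.integrable_toReal_rnDeriv
  have hgi : Integrable (fun x => (μ'.rnDeriv volume x).toReal) volume :=
    Measure.integrable_toReal_rnDeriv
  have H := entBregman_le_of_segment_minimal (a := a / c) (b := b / c) hf hg
    (fun _ => ENNReal.toReal_nonneg) (fun _ => ENNReal.toReal_nonneg) hfi hgi hfl hgl ?_
  · obtain ⟨h0, hi, hle⟩ := H
    refine ⟨_, KL_eq_integral_entBregman hac hac' h0 hi, ?_⟩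
    rw [hE, hE', EReal.toReal_coe, EReal.toReal_coe]
    have h := mul_le_mul_of_nonneg_left hle hc.le
    have h' : c * (a / c) = a := by field_simp
    linarith
  · intro t ht ht'
    have := isProbabilityMeasure_mixture (μ := μ) (μ' := μ') ht.le ht'.le
    have hacm : mixture t μ μ' ≪ volume :=
      Measure.AbsolutelyContinuous.add_left (hac.smul_left _) (hac'.smul_left _)
    have hm := hmin t ht ht'
    rw [Ent_eq_of_rnDeriv_ae_eq hacm (toReal_rnDeriv_mixture ht.le ht'.le)
      (integrable_mix_mul_log hf hg (fun _ => ENNReal.toReal_nonneg)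
        (fun _ => ENNReal.toReal_nonneg) hfi hgi hfl hgl ht ht'), hE, hQ t ht ht'] at hm
    norm_cast at hm
    have h' : t * (a / c + t * (b / c)) = (t * (a + t * b)) / c := by field_simp
    rw [h', add_sub_assoc, div_add' _ _ _ hc.ne']
    refine div_nonneg ?_ hc.le
    linarith

end Segment

section Quadratic

variable {Ω : Type*} [MeasurableSpace Ω] {ρ : Measure Ω} {u v w w' : Ω → ℝ}

lemma integral_sq_segment (hu : MemLp u 2 ρ) (hv : MemLp v 2 ρ) (hw : MemLp w 2 ρ) (t : ℝ) :
    ∫ p, ((1 - t) * u p + t * v p - w p) ^ 2 ∂ρ = ∫ p, (u p - w p) ^ 2 ∂ρ +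
      t * (2 * ∫ p, (u p - w p) * (v p - u p) ∂ρ + t * ∫ p, (v p - u p) ^ 2 ∂ρ) := by
  have h1 : Integrable (fun p => (u p - w p) ^ 2) ρ := (hu.sub hw).integrable_sq
  have h2 : Integrable (fun p => (v p - u p) ^ 2) ρ := (hv.sub hu).integrable_sq
  have h3 : Integrable (fun p => (u p - w p) * (v p - u p)) ρ :=
    (hu.sub hw).integrable_mul (hv.sub hu)
  have h4 : Integrable (fun p => (u p - w p) ^ 2 + 2 * t * ((u p - w p) * (v p - u p))) ρ :=
    h1.add (h3.const_mul _)
  calc _ = ∫ p, ((u p - w p) ^ 2 + 2 * t * ((u p - w p) * (v p - u p))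
        + t ^ 2 * (v p - u p) ^ 2) ∂ρ := by
        congr 1 with p
        ring
    _ = _ := by
        rw [integral_add h4 (h2.const_mul _), integral_add h1 (h3.const_mul _),
          integral_const_mul, integral_const_mul]
        ring

lemma integral_sub_mul_sub_add (hu : MemLp u 2 ρ) (hv : MemLp v 2 ρ) (hw : MemLp w 2 ρ)
    (hw' : MemLp w' 2 ρ) :
    ∫ p, (u p - w p) * (v p - u p) ∂ρ + ∫ p, (v p - w' p) * (u p - v p) ∂ρ =
      -∫ p, (v p - u p) ^ 2 ∂ρ - ∫ p, (w p - w' p) * (v p - u p) ∂ρ := by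
  have h1 : Integrable (fun p => (u p - w p) * (v p - u p)) ρ :=
    (hu.sub hw).integrable_mul (hv.sub hu)
  have h2 : Integrable (fun p => (v p - w' p) * (u p - v p)) ρ :=
    (hv.sub hw').integrable_mul (hu.sub hv)
  have h3 : Integrable (fun p => (v p - u p) ^ 2) ρ := (hv.sub hu).integrable_sq
  have h4 : Integrable (fun p => (w p - w' p) * (v p - u p)) ρ :=
    (hw.sub hw').integrable_mul (hv.sub hu)
  rw [← integral_neg, ← integral_add h1 h2, ← integral_sub (f := fun p => -(v p - u p) ^ 2)
    h3.neg h4]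
  congr 1 with p
  ring

lemma neg_integral_sq_sub_integral_mul_le (hu : MemLp u 2 ρ) (hw : MemLp w 2 ρ) {γ β : ℝ}
    (hγ : 0 < γ) :
    -(γ * ∫ p, u p ^ 2 ∂ρ) - β * ∫ p, w p * u p ∂ρ ≤ β ^ 2 / (4 * γ) * ∫ p, w p ^ 2 ∂ρ := by
  have h1 : Integrable (fun p => γ * u p ^ 2) ρ := hu.integrable_sq.const_mul _
  have h2 : Integrable (fun p => β * (w p * u p)) ρ := (hw.integrable_mul hu).const_mul _
  rw [← integral_const_mul, ← integral_const_mul, ← integral_const_mul, ← integral_neg,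
    ← integral_sub (f := fun p => -(γ * u p ^ 2)) h1.neg h2]
  refine integral_mono (h1.neg.sub h2) (hw.integrable_sq.const_mul _) fun p => ?_
  have h : β ^ 2 / (4 * γ) * w p ^ 2 - (-(γ * u p ^ 2) - β * (w p * u p))
      = (2 * γ * u p + β * w p) ^ 2 / (4 * γ) := by
    field_simp
    ring
  have h' : 0 ≤ (2 * γ * u p + β * w p) ^ 2 / (4 * γ) := by positivity
  dsimp only
  linarith

end Quadratic

section Stage

variable {da dw dx dz : ℕ} {ρ : Measure (Euc da × Euc dw × ℝ)} {ΨA : Euc da → Euc dx → ℝ}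
  {ΨW : Euc dw → Euc dz → ℝ} {R M ζ α β c : ℝ}

lemma memLp_integral_comp [IsProbabilityMeasure ρ] {d e : ℕ} {Ψ : Euc d → Euc e → ℝ}
    (hΨ : Measurable (Function.uncurry Ψ)) (hb : ∀ a x, |Ψ a x| ≤ R)
    {φ : Euc da × Euc dw × ℝ → Euc d} (hφ : Measurable φ) (μ : Measure (Euc e))
    [IsProbabilityMeasure μ] : MemLp (fun p => ∫ x, Ψ (φ p) x ∂μ) 2 ρ := by
  have hm : StronglyMeasurable (Function.uncurry fun p x => Ψ (φ p) x) :=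
    (hΨ.comp ((hφ.comp measurable_fst).prodMk measurable_snd)).stronglyMeasurable
  refine MemLp.of_bound hm.integral_prod_right.aestronglyMeasurable R
    (Eventually.of_forall fun p => ?_)
  simpa using norm_integral_le_of_norm_le_const (μ := μ) (f := Ψ (φ p)) (C := R)
    (Eventually.of_forall (hb (φ p)))

lemma integrable_of_abs_le_s14 {d e : ℕ} {Ψ : Euc d → Euc e → ℝ}
    (hΨ : Measurable (Function.uncurry Ψ)) (hb : ∀ a x, |Ψ a x| ≤ R) (μ : Measure (Euc e))
    [IsFiniteMeasure μ] (a : Euc d) : Integrable (Ψ a) μ :=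
  Integrable.of_bound (hΨ.comp measurable_prodMk_left).aestronglyMeasurable R
    (Eventually.of_forall (hb a))

/-- The first variation of `α U₂ + β F₁(μx, ·)` at `μ` in the direction `μ' - μ`. -/
def stageVariation (ρ : Measure (Euc da × Euc dw × ℝ)) (ΨA : Euc da → Euc dx → ℝ)
    (ΨW : Euc dw → Euc dz → ℝ) (ζ α β : ℝ) (μx : Measure (Euc dx)) (μ μ' : Measure (Euc dz)) :
    ℝ :=
  α * ∫ p, ((∫ z, ΨW p.2.1 z ∂μ) - p.2.2) * ((∫ z, ΨW p.2.1 z ∂μ') - ∫ z, ΨW p.2.1 z ∂μ) ∂ρ +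
  β * (∫ p, ((∫ z, ΨW p.2.1 z ∂μ) - ∫ x, ΨA p.1 x ∂μx)
      * ((∫ z, ΨW p.2.1 z ∂μ') - ∫ z, ΨW p.2.1 z ∂μ) ∂ρ
    + ζ / 2 * ((∫ z, ‖z‖ ^ 2 ∂μ') - ∫ z, ‖z‖ ^ 2 ∂μ))

lemma stage_mixture [IsProbabilityMeasure ρ] (hA1 : A1 ρ M) (hA2 : A2 ΨA ΨW R)
    {μx : Measure (Euc dx)} (hμx : IsP2 μx) {μ μ' : Measure (Euc dz)} (hμ : IsP2 μ)
    (hμ' : IsP2 μ') {t : ℝ} (ht : 0 < t) (ht' : t < 1) :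
    α * U2 ρ ΨW (mixture t μ μ') + β * F1 ρ ΨA ΨW ζ μx (mixture t μ μ') =
      α * U2 ρ ΨW μ + β * F1 ρ ΨA ΨW ζ μx μ + t * (stageVariation ρ ΨA ΨW ζ α β μx μ μ' +
        t * ((α + β) / 2 *
          ∫ p, ((∫ z, ΨW p.2.1 z ∂μ') - ∫ z, ΨW p.2.1 z ∂μ) ^ 2 ∂ρ)) := by
  obtain ⟨hAm, hWm, hAb, hWb, -⟩ := hA2
  have := hμx.1
  have := hμ.1
  have := hμ'.1
  have hu := memLp_integral_comp (ρ := ρ) hWm hWb (measurable_fst.comp measurable_snd) μ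
  have hv := memLp_integral_comp (ρ := ρ) hWm hWb (measurable_fst.comp measurable_snd) μ'
  have hA := memLp_integral_comp (ρ := ρ) hAm hAb measurable_fst μx
  have hy : MemLp (fun p : Euc da × Euc dw × ℝ => p.2.2) 2 ρ :=
    MemLp.of_bound (measurable_snd.comp measurable_snd).aestronglyMeasurable M hA1
  have hmix : ∀ w, ∫ z, ΨW w z ∂(mixture t μ μ') =
      (1 - t) * ∫ z, ΨW w z ∂μ + t * ∫ z, ΨW w z ∂μ' := fun w =>
    integral_mixture (integrable_of_abs_le_s14 hWm hWb μ w) (integrable_of_abs_le_s14 hWm hWb μ' w)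
      ht.le ht'.le
  have h1 := integral_sq_segment hu hv hy t
  have h2 := integral_sq_segment hu hv hA t
  dsimp only [Function.comp_apply] at h1 h2
  simp only [U2, F1, U1, stageVariation, hmix]
  rw [integral_mixture hμ.2 hμ'.2 ht.le ht'.le, h1, h2]
  ring

lemma stageVariation_add_le [IsProbabilityMeasure ρ] (hA1 : A1 ρ M) (hA2 : A2 ΨA ΨW R)
    (hα : 0 ≤ α) (hβ : 0 < β)
    {μx μx' : Measure (Euc dx)} (hμx : IsP2 μx) (hμx' : IsP2 μx') {μ μ' : Measure (Euc dz)}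
    (hμ : IsP2 μ) (hμ' : IsP2 μ') :
    stageVariation ρ ΨA ΨW ζ α β μx μ μ' + stageVariation ρ ΨA ΨW ζ α β μx' μ' μ ≤
      β ^ 2 / (4 * (α + β)) *
        ∫ p, ((∫ x, ΨA p.1 x ∂μx) - (∫ x, ΨA p.1 x ∂μx')) ^ 2 ∂ρ := by
  obtain ⟨hAm, hWm, hAb, hWb, -⟩ := hA2
  have := hμx.1
  have := hμx'.1
  have := hμ.1
  have := hμ'.1
  have hu := memLp_integral_comp (ρ := ρ) hWm hWb (measurable_fst.comp measurable_snd) μ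
  have hv := memLp_integral_comp (ρ := ρ) hWm hWb (measurable_fst.comp measurable_snd) μ'
  have hA := memLp_integral_comp (ρ := ρ) hAm hAb measurable_fst μx
  have hA' := memLp_integral_comp (ρ := ρ) hAm hAb measurable_fst μx'
  have hy : MemLp (fun p : Euc da × Euc dw × ℝ => p.2.2) 2 ρ :=
    MemLp.of_bound (measurable_snd.comp measurable_snd).aestronglyMeasurable M hA1
  have h1 := integral_sub_mul_sub_add hu hv hy hy
  have h2 := integral_sub_mul_sub_add hu hv hA hA'
  have h3 := neg_integral_sq_sub_integral_mul_le (β := β) (hv.sub hu) (hA.sub hA')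
    (add_pos_of_nonneg_of_pos hα hβ)
  simp only [Function.comp_apply, Pi.sub_apply, sub_self, zero_mul, integral_zero, sub_zero]
    at h1 h2 h3
  refine le_trans (le_of_eq ?_) h3
  unfold stageVariation
  linear_combination α * h1 + β * h2

/-- Stability in `μx` of the minimizers of `α U₂ + β F₁(μx, ·) + c Ent`. -/
lemma symm_KL_le_of_minimal [IsProbabilityMeasure ρ] (hA1 : A1 ρ M) (hA2 : A2 ΨA ΨW R)
    (hα : 0 ≤ α) (hβ : 0 < β) (hc : 0 < c)
    {μx μx' : Measure (Euc dx)} (hμx : IsP2 μx) (hμx' : IsP2 μx')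
    {J J' : Measure (Euc dz) → EReal}
    (hJ : ∀ ν, J ν = ((α * U2 ρ ΨW ν + β * F1 ρ ΨA ΨW ζ μx ν : ℝ) : EReal) + c * Ent ν)
    (hJ' : ∀ ν, J' ν = ((α * U2 ρ ΨW ν + β * F1 ρ ΨA ΨW ζ μx' ν : ℝ) : EReal) + c * Ent ν)
    {μ μ' : Measure (Euc dz)} (hμ : IsP2 μ) (hμ' : IsP2 μ') (hfin : J μ ≠ ⊤) (hfin' : J' μ' ≠ ⊤)
    (hmin : ∀ ν, IsP2 ν → J μ ≤ J ν) (hmin' : ∀ ν, IsP2 ν → J' μ' ≤ J' ν) :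
    (c : EReal) * (KL μ μ' + KL μ' μ) ≤
      ((β ^ 2 / (4 * (α + β)) *
        ∫ p, ((∫ x, ΨA p.1 x ∂μx) - (∫ x, ΨA p.1 x ∂μx')) ^ 2 ∂ρ : ℝ) : EReal) := by
  have := hμ.1
  have := hμ'.1
  have hE : Ent μ ≠ ⊤ := fun h => hfin (by
    rw [hJ, h, EReal.coe_mul_top_of_pos hc, EReal.coe_add_top])
  have hE' : Ent μ' ≠ ⊤ := fun h => hfin' (by
    rw [hJ', h, EReal.coe_mul_top_of_pos hc, EReal.coe_add_top])
  obtain ⟨k, hk, hle⟩ := KL_le_of_minimal_on_segment hE hE' hc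
    (Q := fun ν => α * U2 ρ ΨW ν + β * F1 ρ ΨA ΨW ζ μx ν)
    (fun t ht ht' => stage_mixture (ζ := ζ) (α := α) (β := β) hA1 hA2 hμx hμ hμ' ht ht')
    (fun t ht ht' => by
      rw [← hJ, ← hJ]
      exact hmin _ (hμ.mixture hμ' ht.le ht'.le))
  obtain ⟨k', hk', hle'⟩ := KL_le_of_minimal_on_segment hE' hE hc
    (Q := fun ν => α * U2 ρ ΨW ν + β * F1 ρ ΨA ΨW ζ μx' ν)
    (fun t ht ht' => stage_mixture (ζ := ζ) (α := α) (β := β) hA1 hA2 hμx' hμ' hμ ht ht')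
    (fun t ht ht' => by
      rw [← hJ', ← hJ']
      exact hmin' _ (hμ'.mixture hμ ht.le ht'.le))
  have h := stageVariation_add_le (ζ := ζ) hA1 hA2 hα hβ hμx hμx' hμ hμ'
  rw [hk, hk', ← EReal.coe_add, ← EReal.coe_mul, EReal.coe_le_coe_iff]
  linarith

end Stage

/-- Proposition B.4 / continuity of the Stage-I solution maps: symmetrized
KL bounds between minimizers of the (tilted) Stage-I objectives at different `μ_x`. -/
theorem stmt14
    {da dw dx dz : ℕ} (hda : 0 < da) (hdw : 0 < dw) (hdx : 0 < dx) (hdz : 0 < dz)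
    (R M ζ1 σ1 : ℝ) (hR : 0 < R) (hM : 0 < M) (hζ1 : 0 < ζ1) (hσ1 : 0 < σ1)
    (lam : ℝ) (hlam : 0 < lam)
    (ρ : Measure (Euc da × Euc dw × ℝ)) (hρ : IsProbabilityMeasure ρ)
    (ΨA : Euc da → Euc dx → ℝ) (ΨW : Euc dw → Euc dz → ℝ)
    (hA1 : A1 ρ M) (hA2 : A2 ΨA ΨW R)
    (μx μx' : Measure (Euc dx)) (hμx : IsP2 μx) (hμx' : IsP2 μx') :
    (∀ μt μt' : Measure (Euc dz), IsP2 μt → IsP2 μt' →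
      Gtilt ρ ΨA ΨW ζ1 σ1 lam μx μt ≠ ⊤ → Gtilt ρ ΨA ΨW ζ1 σ1 lam μx μt ≠ ⊥ →
      (∀ ν, IsP2 ν → Gtilt ρ ΨA ΨW ζ1 σ1 lam μx μt ≤ Gtilt ρ ΨA ΨW ζ1 σ1 lam μx ν) →
      Gtilt ρ ΨA ΨW ζ1 σ1 lam μx' μt' ≠ ⊤ → Gtilt ρ ΨA ΨW ζ1 σ1 lam μx' μt' ≠ ⊥ →
      (∀ ν, IsP2 ν → Gtilt ρ ΨA ΨW ζ1 σ1 lam μx' μt' ≤ Gtilt ρ ΨA ΨW ζ1 σ1 lam μx' ν) →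
      ((lam * σ1 : ℝ) : EReal) * (KL μt μt' + KL μt' μt) ≤
        ((lam ^ 2 / (4 * (1 + lam)) *
          ∫ p, ((∫ x, ΨA p.1 x ∂μx) - (∫ x, ΨA p.1 x ∂μx')) ^ 2 ∂ρ : ℝ) : EReal)) ∧
    (∀ μ μ' : Measure (Euc dz), IsP2 μ → IsP2 μ' →
      calF1 ρ ΨA ΨW ζ1 σ1 μx μ ≠ ⊤ → calF1 ρ ΨA ΨW ζ1 σ1 μx μ ≠ ⊥ →
      (∀ ν, IsP2 ν → calF1 ρ ΨA ΨW ζ1 σ1 μx μ ≤ calF1 ρ ΨA ΨW ζ1 σ1 μx ν) →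
      calF1 ρ ΨA ΨW ζ1 σ1 μx' μ' ≠ ⊤ → calF1 ρ ΨA ΨW ζ1 σ1 μx' μ' ≠ ⊥ →
      (∀ ν, IsP2 ν → calF1 ρ ΨA ΨW ζ1 σ1 μx' μ' ≤ calF1 ρ ΨA ΨW ζ1 σ1 μx' ν) →
      ((σ1 : ℝ) : EReal) * (KL μ μ' + KL μ' μ) ≤
        (((1 / 4) *
          ∫ p, ((∫ x, ΨA p.1 x ∂μx) - (∫ x, ΨA p.1 x ∂μx')) ^ 2 ∂ρ : ℝ) : EReal)) := by
  constructor
  · intro μt μt' hμt hμt' hfin _ hmin hfin' _ hmin'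
    exact symm_KL_le_of_minimal (α := 1) (β := lam) (ζ := ζ1) hA1 hA2 zero_le_one hlam
      (mul_pos hlam hσ1) hμx hμx' (fun ν => by rw [Gtilt, one_mul]) (fun ν => by rw [Gtilt, one_mul])
      hμt hμt' hfin hfin' hmin hmin'
  · intro μ μ' hμ hμ' hfin _ hmin hfin' _ hmin'
    have h := symm_KL_le_of_minimal (α := 0) (β := 1) (ζ := ζ1) hA1 hA2 le_rfl one_pos hσ1 hμx hμx'
      (fun ν => by rw [calF1, zero_mul, zero_add, one_mul])
      (fun ν => by rw [calF1, zero_mul, zero_add, one_mul]) hμ hμ' hfin hfin' hmin hmin'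
    rwa [one_pow, zero_add, mul_one] at h
end
end
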